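/- Let D be a positive integer, b > 0, c > 0, and a ≤ b²/(3c). Then there exist C > 0 and a summable sequence (γ_j) of nonnegative real numbers such that ∫_{ℝ^D} exp( z·σ − a|σ|² − b|σ|⁴ − c|σ|⁶ ) dσ = C ∏_{j=1}^∞ (1 + γ_j z²) for all z ∈ ℂ^D. -/

import Mathlib

open MeasureTheory Complex

noncomputable section

/-- Complex bilinear dot product `z · w = Σ_j z_j w_j` (no conjugation). -/
def cdot {D : ℕ} (z w : Fin D → ℂ) : ℂ := ∑ j, z j * w j

/-- Real scalar product. -/
def rdot {D : ℕ} (x y : Fin D → ℝ) : ℝ := ∑ j, x j * y j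

/-- Pairing `z · σ = Σ_j z_j σ_j` of a complex vector with a real vector. -/
def cpair {D : ℕ} (z : Fin D → ℂ) (σ : Fin D → ℝ) : ℂ := ∑ j, z j * (σ j : ℂ)

namespace LeeYang

open Polynomial Filter Topology

/-- Real polynomials that are zero, or have nonnegative coefficients, positive constant term and
no zeros in the open upper half-plane (hence only negative zeros). -/
def NegRooted (p : ℝ[X]) : Prop :=
  (∀ n, 0 ≤ p.coeff n) ∧ (p = 0 ∨ 0 < p.coeff 0 ∧ ∀ w : ℂ, 0 < w.im → aeval w p ≠ 0)

namespace NegRooted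

variable {p : ℝ[X]}

lemma zero : NegRooted 0 := ⟨by simp, Or.inl rfl⟩

lemma im_eq_zero_and_re_neg (hp : NegRooted p) (h0 : p ≠ 0) {ρ : ℂ} (hρ : aeval ρ p = 0) :
    ρ.im = 0 ∧ ρ.re < 0 := by
  obtain ⟨hpos, hne⟩ := hp.2.resolve_left h0
  have him : ρ.im = 0 := by
    rcases lt_trichotomy ρ.im 0 with h | h | h
    · refine absurd ?_ (hne ((starRingEnd ℂ) ρ) (by simpa using h))
      rw [Polynomial.aeval_conj, hρ, map_zero]
    · exact h
    · exact absurd hρ (hne ρ h)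
  refine ⟨him, ?_⟩
  by_contra! hre
  have hρ' : ρ = (ρ.re : ℂ) := Complex.ext rfl (by simp [him])
  rw [hρ', ← Complex.coe_algebraMap, aeval_algebraMap_apply, Complex.coe_algebraMap,
    Complex.ofReal_eq_zero, aeval_eq_sum_range] at hρ
  have : 0 < ∑ i ∈ Finset.range (p.natDegree + 1), p.coeff i • ρ.re ^ i := by
    rw [Finset.sum_range_succ']
    have := Finset.sum_nonneg (s := Finset.range p.natDegree)
      (f := fun i => p.coeff (i + 1) • ρ.re ^ (i + 1))
      (fun i _ => mul_nonneg (hp.1 _) (pow_nonneg hre _))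
    simp only [pow_zero, smul_eq_mul, mul_one] at this ⊢
    linarith
  exact this.ne' hρ

lemma logDeriv_eq (w : ℂ) (hw : aeval w p ≠ 0) :
    aeval w (derivative p) / aeval w p =
      ((p.map (algebraMap ℝ ℂ)).roots.map fun ρ => 1 / (w - ρ)).sum := by
  have := (IsAlgClosed.splits (p.map (algebraMap ℝ ℂ))).eval_derivative_div_eval_of_ne_zero
    (x := w) (by rwa [eval_map_algebraMap])
  rwa [derivative_map, eval_map_algebraMap, eval_map_algebraMap] at this

lemma mem_roots (hp : NegRooted p) (h0 : p ≠ 0) {ρ : ℂ}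
    (hρ : ρ ∈ (p.map (algebraMap ℝ ℂ)).roots) : ρ.im = 0 ∧ ρ.re < 0 := by
  refine hp.im_eq_zero_and_re_neg h0 ?_
  have := isRoot_of_mem_roots hρ
  rwa [IsRoot.def, eval_map_algebraMap] at this

lemma im_multiset_sum (s : Multiset ℂ) : s.sum.im = (s.map Complex.im).sum :=
  map_multiset_sum Complex.imAddGroupHom s

lemma im_mul_logDeriv_nonneg (hp : NegRooted p) (h0 : p ≠ 0) {w : ℂ} (hw : 0 < w.im) :
    0 ≤ (w * (aeval w (derivative p) / aeval w p)).im := by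
  have hne := (hp.2.resolve_left h0).2 w hw
  rw [logDeriv_eq w hne, ← Multiset.sum_map_mul_left, im_multiset_sum]
  refine Multiset.sum_nonneg ?_
  simp only [Multiset.map_map, Multiset.mem_map, Function.comp]
  rintro _ ⟨ρ, hρ, rfl⟩
  obtain ⟨hi, hr⟩ := hp.mem_roots h0 hρ
  have hn : 0 < normSq (w - ρ) := normSq_pos.2 (fun h => by
    have := congrArg Complex.im h; simp [hi] at this; linarith)
  have : (w * (1 / (w - ρ))).im = -ρ.re * w.im / normSq (w - ρ) := by
    simp [Complex.mul_im, Complex.inv_re, Complex.inv_im, hi]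
    field_simp
    ring
  rw [this]
  exact div_nonneg (mul_nonneg (by linarith) hw.le) hn.le

lemma im_logDeriv_neg (hp : NegRooted p) (h0 : p ≠ 0) (hd : p.natDegree ≠ 0) {w : ℂ}
    (hw : 0 < w.im) : (aeval w (derivative p) / aeval w p).im < 0 := by
  have hne := (hp.2.resolve_left h0).2 w hw
  rw [logDeriv_eq w hne, im_multiset_sum, Multiset.map_map]
  have key : ∀ ρ ∈ (p.map (algebraMap ℝ ℂ)).roots,
      (Complex.im ∘ fun ρ => 1 / (w - ρ)) ρ < (fun _ => (0 : ℝ)) ρ := by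
    intro ρ hρ
    obtain ⟨hi, hr⟩ := hp.mem_roots h0 hρ
    have hn : 0 < normSq (w - ρ) := normSq_pos.2 (fun h => by
      have := congrArg Complex.im h; simp [hi] at this; linarith)
    simp only [Function.comp, one_div, Complex.inv_im, Complex.sub_im, hi, sub_zero]
    exact div_neg_of_neg_of_pos (by linarith) hn
  have hcard : (p.map (algebraMap ℝ ℂ)).roots ≠ ∅ := by
    intro h
    have h1 := (IsAlgClosed.splits (p.map (algebraMap ℝ ℂ))).natDegree_eq_card_roots
    rw [h, natDegree_map] at h1
    exact hd h1
  simpa using Multiset.sum_lt_sum_of_nonempty hcard key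

lemma derivative (hp : NegRooted p) : NegRooted (derivative p) := by
  have hc : ∀ n, 0 ≤ (Polynomial.derivative p).coeff n := fun n => by
    rw [coeff_derivative]; exact mul_nonneg (hp.1 _) (by positivity)
  by_cases hd : p.natDegree = 0
  · rw [derivative_of_natDegree_zero hd]; exact zero
  have h0 : p ≠ 0 := fun h => hd (by simp [h])
  have hne : ∀ w : ℂ, 0 < w.im → aeval w (Polynomial.derivative p) ≠ 0 := fun w hw h => by
    have := hp.im_logDeriv_neg h0 hd hw
    simp [h] at this
  refine ⟨hc, Or.inr ⟨lt_of_le_of_ne (hc 0) fun h => ?_, hne⟩⟩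
  rw [coeff_derivative] at h
  have h1 : p.coeff 1 = 0 := by simpa using h.symm
  have h2 : aeval (0 : ℂ) (Polynomial.derivative p) = 0 := by
    rw [← coeff_zero_eq_aeval_zero', coeff_derivative]; simp [h1]
  have hp0 : aeval (0 : ℂ) p ≠ 0 := by
    rw [← coeff_zero_eq_aeval_zero']
    simpa using (hp.2.resolve_left h0).1.ne'
  have h3 := logDeriv_eq 0 hp0
  rw [h2, zero_div] at h3
  have key : ∀ ρ ∈ (p.map (algebraMap ℝ ℂ)).roots,
      (fun _ => (0 : ℝ)) ρ < (fun ρ => (1 / (0 - ρ)).re) ρ := by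
    intro ρ hρ
    obtain ⟨hi, hr⟩ := hp.mem_roots h0 hρ
    have hn : 0 < normSq ρ := normSq_pos.2 (fun h => by simp [h] at hr)
    simp only [one_div, zero_sub, Complex.inv_re, Complex.neg_re, normSq_neg]
    exact div_pos (by linarith) hn
  have hcard : (p.map (algebraMap ℝ ℂ)).roots ≠ ∅ := by
    intro h
    have h1 := (IsAlgClosed.splits (p.map (algebraMap ℝ ℂ))).natDegree_eq_card_roots
    rw [h, natDegree_map] at h1
    exact hd h1
  have h4 := Multiset.sum_lt_sum_of_nonempty hcard key
  have h5 := congrArg Complex.re h3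
  rw [show ∀ s : Multiset ℂ, s.sum.re = (s.map Complex.re).sum from
    map_multiset_sum Complex.reAddGroupHom, Multiset.map_map] at h5
  simp only [Multiset.map_const', Multiset.sum_replicate, smul_zero] at h4
  exact h4.ne h5

/-- The operator `p ↦ μ p + ν (4 w ∂²p + 2 D ∂p)` preserves negative-rootedness. -/
lemma besselOp (hp : NegRooted p) {μ ν : ℝ} (hμ : 0 < μ) (hν : 0 ≤ ν) (D : ℕ) :
    NegRooted (C μ * p + C ν * (4 * X * Polynomial.derivative (Polynomial.derivative p) +
      C (2 * (D : ℝ)) * Polynomial.derivative p)) := by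
  by_cases h0 : p = 0
  · simpa [h0] using zero
  obtain ⟨hpos, hne⟩ := hp.2.resolve_left h0
  have hp' := hp.derivative
  have hp'' := hp'.derivative
  have hX : ∀ n, 0 ≤ (4 * X * Polynomial.derivative (Polynomial.derivative p)).coeff n := by
    intro n
    rw [show (4 : ℝ[X]) = C 4 from rfl, mul_assoc, coeff_C_mul]
    rcases n with _ | n
    · simp
    · rw [coeff_X_mul]; exact mul_nonneg (by norm_num) (hp''.1 _)
  have hc : ∀ n, 0 ≤ (C ν * (4 * X * Polynomial.derivative (Polynomial.derivative p) +
      C (2 * (D : ℝ)) * Polynomial.derivative p)).coeff n := by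
    intro n
    rw [coeff_C_mul, coeff_add, coeff_C_mul]
    have := hX n
    have := hp'.1 n
    positivity
  refine ⟨fun n => ?_, Or.inr ⟨?_, fun w hw h => ?_⟩⟩
  · rw [coeff_add, coeff_C_mul]
    exact add_nonneg (mul_nonneg hμ.le (hp.1 n)) (hc n)
  · rw [coeff_add, coeff_C_mul]
    exact add_pos_of_pos_of_nonneg (mul_pos hμ hpos) (hc 0)
  · have hpw := hne w hw
    simp only [map_add, map_mul, aeval_C, aeval_X, Complex.coe_algebraMap, map_ofNat] at h
    by_cases hd : p.natDegree = 0
    · rw [derivative_of_natDegree_zero hd] at h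
      simp [hμ.ne', hpw] at h
    have hd0 : Polynomial.derivative p ≠ 0 := fun h' => hd (Polynomial.derivative_eq_zero.1 h')
    have hpw' := (hp'.2.resolve_left hd0).2 w hw
    have h1 := hp.im_logDeriv_neg h0 hd hw
    have h2 := hp'.im_mul_logDeriv_nonneg hd0 hw
    set A := aeval w p
    set B := aeval w (Polynomial.derivative p)
    set E := aeval w (Polynomial.derivative (Polynomial.derivative p))
    have h3 : (μ : ℂ) * (A / B) + ν * (4 * (w * (E / B)) + 2 * D) = 0 := by
      have : (μ : ℂ) * (A / B) + ν * (4 * (w * (E / B)) + 2 * D) =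
          (μ * A + ν * (4 * w * E + 2 * ((D : ℝ) : ℂ) * B)) / B := by
        push_cast; field_simp
      rw [this, h, zero_div]
    have h4 : 0 < (A / B).im := by
      rw [← inv_div, Complex.inv_im]
      refine div_pos (by linarith) (normSq_pos.2 fun h' => ?_)
      rw [h'] at h1; simp at h1
    have h5 := congrArg Complex.im h3
    have e1 : ((μ : ℂ) * (A / B) + ν * (4 * (w * (E / B)) + 2 * D)).im =
        μ * (A / B).im + ν * (4 * (w * (E / B)).im) := by
      rw [Complex.add_im, Complex.im_ofReal_mul, Complex.im_ofReal_mul, Complex.add_im]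
      have : (2 * (D : ℂ)).im = 0 := by simp
      rw [this, add_zero, show (4 : ℂ) = ((4 : ℝ) : ℂ) by norm_num, Complex.im_ofReal_mul]
    rw [e1] at h5
    have := mul_pos hμ h4
    have := mul_nonneg hν h2
    simp only [Complex.zero_im] at h5
    linarith

/-- The Laguerre recurrence step `p ↦ w ∂p + (a + e w) p` preserves negative-rootedness. -/
lemma laguerreStep (hp : NegRooted p) {a e : ℝ} (ha : 0 < a) (he : 0 < e) :
    NegRooted (X * Polynomial.derivative p + (C a + C e * X) * p) := by
  by_cases h0 : p = 0
  · simpa [h0] using zero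
  obtain ⟨hpos, hne⟩ := hp.2.resolve_left h0
  have hcX : ∀ {q : ℝ[X]}, (∀ n, 0 ≤ q.coeff n) → ∀ n, 0 ≤ (X * q).coeff n := by
    intro q hq n
    rcases n with _ | n
    · simp
    · rw [coeff_X_mul]; exact hq _
  refine ⟨fun n => ?_, Or.inr ⟨?_, fun w hw h => ?_⟩⟩
  · rw [add_mul, coeff_add, coeff_add, mul_assoc, coeff_C_mul, coeff_C_mul]
    have h1 := hcX hp.derivative.1 n
    have h2 := hcX hp.1 n
    have h3 := hp.1 n
    positivity
  · simpa using mul_pos ha hpos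
  · have hpw := hne w hw
    simp only [map_add, map_mul, aeval_C, aeval_X, Complex.coe_algebraMap] at h
    have h1 := hp.im_mul_logDeriv_nonneg h0 hw
    have h3 : w * (aeval w (Polynomial.derivative p) / aeval w p) + (a + e * w) = 0 := by
      field_simp
      linear_combination h
    have h4 := congrArg Complex.im h3
    simp only [Complex.add_im, Complex.ofReal_im, Complex.im_ofReal_mul, Complex.zero_im] at h4
    have := mul_pos he hw
    linarith

lemma one : NegRooted 1 :=
  ⟨fun n => by rw [coeff_one]; split_ifs <;> norm_num, Or.inr ⟨by simp, fun w _ => by simp⟩⟩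

lemma C_mul (hp : NegRooted p) {t : ℝ} (ht : 0 < t) : NegRooted (C t * p) := by
  simpa using hp.besselOp ht le_rfl 0

lemma scale (hp : NegRooted p) {t : ℝ} (ht : 0 < t) : NegRooted (p.comp (C t * X)) := by
  by_cases h0 : p = 0
  · simpa [h0] using zero
  obtain ⟨hpos, hne⟩ := hp.2.resolve_left h0
  refine ⟨fun n => ?_, Or.inr ⟨by simpa using hpos, fun w hw h => ?_⟩⟩
  · rw [comp_C_mul_X_coeff]; exact mul_nonneg (hp.1 n) (pow_nonneg ht.le _)
  · refine hne (t * w) (by rw [Complex.im_ofReal_mul]; positivity) ?_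
    simpa [aeval_comp] using h

lemma exists_multiset (hp : NegRooted p) (h0 : p ≠ 0) :
    ∃ s : Multiset ℝ, (∀ γ ∈ s, 0 ≤ γ) ∧
      ∀ w : ℂ, aeval w p = p.coeff 0 * (s.map fun γ : ℝ => 1 + (γ : ℂ) * w).prod := by
  refine ⟨(p.map (algebraMap ℝ ℂ)).roots.map fun ρ => -1 / ρ.re, ?_, fun w => ?_⟩
  · simp only [Multiset.mem_map]
    rintro _ ⟨ρ, hρ, rfl⟩
    exact div_nonneg_of_nonpos (by norm_num) (hp.mem_roots h0 hρ).2.le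
  · have key : ∀ w : ℂ, aeval w p = (p.map (algebraMap ℝ ℂ)).leadingCoeff *
        ((p.map (algebraMap ℝ ℂ)).roots.map fun ρ => w - ρ).prod := by
      intro w
      have := congrArg (eval w) (IsAlgClosed.splits (p.map (algebraMap ℝ ℂ))).eq_prod_roots
      rw [eval_map_algebraMap] at this
      rw [this, eval_mul, eval_C, eval_multiset_prod, Multiset.map_map]
      simp
    have hc : (p.coeff 0 : ℂ) = aeval (0 : ℂ) p := by
      rw [← coeff_zero_eq_aeval_zero']; simp
    rw [hc, key w, key 0, mul_assoc, Multiset.map_map, ← Multiset.prod_map_mul]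
    congr 2
    refine Multiset.map_congr rfl fun ρ hρ => ?_
    obtain ⟨hi, hr⟩ := hp.mem_roots h0 hρ
    have hr' : (ρ.re : ℂ) ≠ 0 := Complex.ofReal_ne_zero.2 hr.ne
    rw [show ρ = (ρ.re : ℂ) from Complex.ext rfl (by simp [hi])]
    simp only [Function.comp, Complex.ofReal_re]
    push_cast
    field_simp
    ring

/-- A negative-rooted polynomial factors as `p 0 * ∏ (1 + γ j * w)` with `γ` nonnegative and
finitely supported, `γ j` decaying like `1 / (j + 1)` uniformly in terms of `∑ γ`. -/
lemma exists_prod (hp : NegRooted p) (h0 : p ≠ 0) :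
    ∃ (n : ℕ) (γ : ℕ → ℝ), (∀ j, 0 ≤ γ j) ∧ (∀ j, n ≤ j → γ j = 0) ∧
      (∀ j, (j + 1) * γ j ≤ ∑ i ∈ Finset.range n, γ i) ∧
      ∀ w : ℂ, aeval w p = p.coeff 0 * ∏ j ∈ Finset.range n, (1 + (γ j : ℂ) * w) := by
  obtain ⟨s, hs, hprod⟩ := hp.exists_multiset h0
  set l := s.sort (· ≥ ·) with hl
  have hl' : (l : Multiset ℝ) = s := Multiset.sort_eq _ _
  have hpw : l.Pairwise (· ≥ ·) := Multiset.pairwise_sort _ _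
  have hmem : ∀ γ ∈ l, 0 ≤ γ := fun γ hγ => hs γ (by rw [← hl']; exact hγ)
  have hnn : ∀ j, 0 ≤ l.getD j 0 := fun j => by
    by_cases hj : j < l.length
    · rw [List.getD_eq_getElem _ _ hj]; exact hmem _ (List.getElem_mem hj)
    · rw [List.getD_eq_default _ _ (not_lt.1 hj)]
  refine ⟨l.length, fun j => l.getD j 0, hnn, fun j hj => List.getD_eq_default _ _ hj,
    fun j => ?_, fun w => ?_⟩
  · beta_reduce
    by_cases hj : j < l.length
    · calc (j + 1) * l.getD j 0 = ∑ i ∈ Finset.range (j + 1), l.getD j 0 := by simp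
        _ ≤ ∑ i ∈ Finset.range (j + 1), l.getD i 0 := by
          refine Finset.sum_le_sum fun i hi => ?_
          have hi' : i ≤ j := Nat.lt_succ_iff.1 (Finset.mem_range.1 hi)
          rw [List.getD_eq_getElem _ _ hj, List.getD_eq_getElem _ _ (hi'.trans_lt hj)]
          rcases hi'.eq_or_lt with rfl | h
          · exact le_rfl
          · exact List.pairwise_iff_getElem.1 hpw i j _ _ h
        _ ≤ ∑ i ∈ Finset.range l.length, l.getD i 0 :=
          Finset.sum_le_sum_of_subset_of_nonneg (Finset.range_subset_range.2 hj) fun i _ _ => hnn i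
    · rw [List.getD_eq_default _ _ (not_lt.1 hj), mul_zero]
      exact Finset.sum_nonneg fun i _ => hnn i
  · rw [hprod w, ← hl', Multiset.map_coe, Multiset.prod_coe, Finset.prod_range,
      ← List.prod_ofFn]
    congr 2
    refine List.ext_getElem (by simp) fun i h1 h2 => ?_
    simp

end NegRooted

lemma one_add_sum_le_prod {ι : Type*} (t : Finset ι) {x : ι → ℝ} (hx : ∀ i, 0 ≤ x i) :
    1 + ∑ i ∈ t, x i ≤ ∏ i ∈ t, (1 + x i) := by
  classical
  induction t using Finset.induction_on with
  | empty => simp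
  | insert i t hi ih =>
    rw [Finset.sum_insert hi, Finset.prod_insert hi]
    have := Finset.sum_nonneg (s := t) fun j _ => hx j
    nlinarith [mul_le_mul_of_nonneg_left ih (hx i), mul_nonneg (hx i) this]

/-- Entire functions that are limits, uniformly on discs, of negative-rooted polynomials. -/
def LaguerrePolya (f : ℂ → ℂ) : Prop :=
  Differentiable ℂ f ∧ ∀ R : ℝ, ∀ ε : ℝ, 0 < ε →
    ∃ p, NegRooted p ∧ ∀ w, ‖w‖ ≤ R → ‖f w - aeval w p‖ ≤ ε

namespace LaguerrePolya

variable {f : ℂ → ℂ}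

lemma of_limit
    (h : ∀ R : ℝ, ∀ ε : ℝ, 0 < ε → ∃ g, LaguerrePolya g ∧ ∀ w, ‖w‖ ≤ R → ‖f w - g w‖ ≤ ε) :
    LaguerrePolya f := by
  refine ⟨fun w₀ => ?_, fun R ε hε => ?_⟩
  · choose g hg hfg using fun n : ℕ => h (‖w₀‖ + 1) (1 / ((n : ℝ) + 1)) (by positivity)
    have hu : TendstoUniformlyOn g f atTop (Metric.ball w₀ 1) := by
      rw [Metric.tendstoUniformlyOn_iff]
      intro ε hε
      filter_upwards [tendsto_one_div_add_atTop_nhds_zero_nat.eventually_lt_const hε] with n hn w hw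
      rw [dist_eq_norm]
      refine (hfg n w ?_).trans_lt hn
      linarith [norm_sub_norm_le w w₀, mem_ball_iff_norm.1 hw]
    exact (hu.tendstoLocallyUniformlyOn.differentiableOn
      (Eventually.of_forall fun n => (hg n).1.differentiableOn) Metric.isOpen_ball).differentiableAt
      (Metric.ball_mem_nhds w₀ one_pos)
  obtain ⟨g, hg, hfg⟩ := h R (ε / 2) (half_pos hε)
  obtain ⟨p, hp, hgp⟩ := hg.2 R (ε / 2) (half_pos hε)
  refine ⟨p, hp, fun w hw => ?_⟩
  calc ‖f w - aeval w p‖ = ‖(f w - g w) + (g w - aeval w p)‖ := by ring_nf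
    _ ≤ _ := norm_add_le _ _
    _ ≤ ε := by linarith [hfg w hw, hgp w hw]

lemma norm_deriv_sub_le (hd : Differentiable ℂ f) {p : ℝ[X]} {R ε : ℝ}
    (h : ∀ w, ‖w‖ ≤ R + 1 → ‖f w - aeval w p‖ ≤ ε) {w : ℂ} (hw : ‖w‖ ≤ R) :
    ‖deriv f w - aeval w (derivative p)‖ ≤ ε := by
  have hp : Differentiable ℂ fun w : ℂ => aeval w p := p.differentiable_aeval
  have := Complex.norm_deriv_le_of_forall_mem_sphere_norm_le (c := w) (R := 1) (C := ε)
    (f := fun w => f w - aeval w p) one_pos (hd.sub hp).diffContOnCl (fun z hz => h z ?_)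
  · rwa [deriv_fun_sub hd.differentiableAt hp.differentiableAt, Polynomial.deriv_aeval,
      div_one] at this
  · have h1 : ‖z - w‖ = 1 := by simpa using hz
    calc ‖z‖ = ‖w + (z - w)‖ := by ring_nf
      _ ≤ ‖w‖ + ‖z - w‖ := norm_add_le _ _
      _ ≤ R + 1 := by linarith

lemma differentiable_deriv (hd : Differentiable ℂ f) : Differentiable ℂ (deriv f) :=
  fun w => (hd.analyticAt w).deriv.differentiableAt

lemma deriv (hf : LaguerrePolya f) : LaguerrePolya (deriv f) := by
  refine ⟨differentiable_deriv hf.1, fun R ε hε => ?_⟩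
  obtain ⟨p, hp, h⟩ := hf.2 (R + 1) ε hε
  exact ⟨_, hp.derivative, fun w hw => norm_deriv_sub_le hf.1 h hw⟩

lemma besselOp (hf : LaguerrePolya f) {μ ν : ℝ} (hμ : 0 < μ) (hν : 0 ≤ ν) (D : ℕ) :
    LaguerrePolya fun w => μ * f w +
      ν * (4 * w * _root_.deriv (_root_.deriv f) w + 2 * D * _root_.deriv f w) := by
  have hd1 := differentiable_deriv hf.1
  have hd2 := differentiable_deriv hd1
  refine ⟨((differentiable_const _).mul hf.1).add ((differentiable_const _).mul
    ((((differentiable_const _).mul differentiable_id).mul hd2).add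
      ((differentiable_const _).mul hd1))), fun R ε hε => ?_⟩
  set K := μ + ν * (4 * |R| + 2 * D) with hK
  have hKpos : 0 < K := by positivity
  obtain ⟨p, hp, h⟩ := hf.2 (R + 1 + 1) (ε / K) (by positivity)
  refine ⟨_, hp.besselOp hμ hν D, fun w hw => ?_⟩
  have h0 : ‖f w - aeval w p‖ ≤ ε / K := h w (by linarith)
  have h1' : ∀ w, ‖w‖ ≤ R + 1 → _ := fun w hw => norm_deriv_sub_le hf.1 h (w := w) hw
  have h1 := h1' w (by linarith)
  have h2 := norm_deriv_sub_le hd1 h1' hw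
  have hwR : ‖w‖ ≤ |R| := hw.trans (le_abs_self R)
  simp only [map_add, map_mul, aeval_C, aeval_X, Complex.coe_algebraMap, map_ofNat]
  set A := aeval w p
  set B := aeval w (derivative p)
  set E := aeval w (derivative (derivative p))
  have e : (μ * f w + ν * (4 * w * _root_.deriv (_root_.deriv f) w + 2 * D * _root_.deriv f w) -
      (μ * A + ν * (4 * w * E + ((2 * (D : ℝ) : ℝ) : ℂ) * B)) : ℂ) =
      μ * (f w - A) + ν * (4 * w * (_root_.deriv (_root_.deriv f) w - E) +
        2 * D * (_root_.deriv f w - B)) := by push_cast; ring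
  push_cast at e ⊢
  rw [e]
  calc _ ≤ μ * ‖f w - A‖ + ν * (4 * ‖w‖ * ‖_root_.deriv (_root_.deriv f) w - E‖ +
        2 * D * ‖_root_.deriv f w - B‖) := by
        refine (norm_add_le _ _).trans ?_
        rw [norm_mul, norm_mul (ν : ℂ), Complex.norm_of_nonneg hμ.le, Complex.norm_of_nonneg hν]
        gcongr
        refine (norm_add_le _ _).trans (le_of_eq ?_)
        simp
    _ ≤ μ * (ε / K) + ν * (4 * |R| * (ε / K) + 2 * D * (ε / K)) := by gcongr
    _ = K * (ε / K) := by rw [hK]; ring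
    _ = ε := by field_simp

lemma const_mul (hf : LaguerrePolya f) {t : ℝ} (ht : 0 < t) :
    LaguerrePolya fun w => t * f w := by
  simpa using hf.besselOp ht le_rfl 0

lemma scale (hf : LaguerrePolya f) {t : ℝ} (ht : 0 < t) : LaguerrePolya fun w => f (w * t) := by
  refine ⟨hf.1.comp (differentiable_id.mul_const _), fun R ε hε => ?_⟩
  obtain ⟨p, hp, h⟩ := hf.2 (R * t) ε hε
  refine ⟨_, hp.scale ht, fun w hw => ?_⟩
  have : aeval w (p.comp (C t * X)) = aeval (w * t) p := by
    rw [aeval_comp, map_mul, aeval_C, aeval_X, Complex.coe_algebraMap, mul_comm]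
  rw [this]
  refine h _ ?_
  rw [norm_mul, Complex.norm_of_nonneg ht.le]
  gcongr

/-- A function in the Laguerre–Pólya class with negative zeros is an exponential times a genus zero
canonical product: along an ultrafilter, the factorizations of its polynomial approximations
converge. -/
lemma exists_prod_exp (hf : LaguerrePolya f) {c : ℝ} (hc : 0 < c) (hf0 : f 0 = c) :
    ∃ (α : ℝ) (γ : ℕ → ℝ), 0 ≤ α ∧ (∀ j, 0 ≤ γ j) ∧ Summable γ ∧
      ∀ w, f w = c * Complex.exp (α * w) * ∏' j, (1 + (γ j : ℂ) * w) := by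
  have hε : ∀ n : ℕ, 0 < min (1 / ((n : ℝ) + 1)) (c / 2) := fun n => by positivity
  choose p hp hfp using fun n : ℕ => hf.2 n _ (hε n)
  have hp0 : ∀ n, p n ≠ 0 := by
    intro n h
    have := (hfp n 0 (by simp)).trans (min_le_right _ _)
    rw [h, hf0, map_zero, sub_zero, Complex.norm_of_nonneg hc.le] at this
    linarith
  choose N γ hγ hγ0 hdec hprod using fun n => (hp n).exists_prod (hp0 n)
  have hlim : ∀ w, Tendsto (fun n => aeval w (p n)) atTop (𝓝 (f w)) := by
    intro w
    rw [tendsto_iff_norm_sub_tendsto_zero]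
    refine squeeze_zero' (Eventually.of_forall fun _ => norm_nonneg _) ?_
      (tendsto_one_div_add_atTop_nhds_zero_nat (𝕜 := ℝ))
    filter_upwards [eventually_ge_atTop ⌈‖w‖⌉₊] with n hn
    rw [norm_sub_rev]
    exact (hfp n w ((Nat.le_ceil _).trans (by exact_mod_cast hn))).trans (min_le_left _ _)
  have hcoeff : ∀ n, aeval (0 : ℂ) (p n) = (p n).coeff 0 := fun n => by
    rw [← coeff_zero_eq_aeval_zero']; simp
  have hpos : ∀ n, 0 < (p n).coeff 0 := fun n => ((hp n).2.resolve_left (hp0 n)).1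
  have hratio : ∀ w, Tendsto (fun n => ∏ j ∈ Finset.range (N n), (1 + (γ n j : ℂ) * w)) atTop
      (𝓝 (f w / c)) := by
    intro w
    have h1 := (hlim w).div (hlim 0) (by rw [hf0]; exact_mod_cast hc.ne')
    rw [hf0] at h1
    refine h1.congr fun n => ?_
    have : ((p n).coeff 0 : ℂ) ≠ 0 := by exact_mod_cast (hpos n).ne'
    rw [Pi.div_apply, hcoeff, hprod n w, mul_div_cancel_left₀ _ this]
  set S : ℕ → ℝ := fun n => ∑ j ∈ Finset.range (N n), γ n j with hS
  have hSnn : ∀ n, 0 ≤ S n := fun n => Finset.sum_nonneg fun j _ => hγ n j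
  obtain ⟨M, hM⟩ : ∃ M, ∀ n, S n ≤ M := by
    obtain ⟨M, hM⟩ := (hratio 1).norm.bddAbove_range
    refine ⟨M, fun n => le_trans ?_ (hM ⟨n, rfl⟩)⟩
    have e : ∏ j ∈ Finset.range (N n), (1 + (γ n j : ℂ) * 1) =
        ((∏ j ∈ Finset.range (N n), (1 + γ n j) : ℝ) : ℂ) := by push_cast; simp
    beta_reduce
    rw [e, Complex.norm_of_nonneg (Finset.prod_nonneg fun j _ => by linarith [hγ n j])]
    linarith [one_add_sum_le_prod (Finset.range (N n)) (hγ n)]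
  have hM0 : 0 ≤ M := (hSnn 0).trans (hM 0)
  have hdec' : ∀ n j, γ n j ≤ M / (j + 1) := fun n j => by
    rw [le_div_iff₀ (by positivity), mul_comm]
    exact (hdec n j).trans (hM n)
  have hpart : ∀ n k, ∑ j ∈ Finset.range k, γ n j ≤ S n := fun n k => by
    rw [hS]
    rcases le_total k (N n) with h | h
    · exact Finset.sum_le_sum_of_subset_of_nonneg (Finset.range_subset_range.2 h)
        fun i _ _ => hγ n i
    · refine (Finset.sum_subset (Finset.range_subset_range.2 h) fun i _ hi => hγ0 n i ?_).ge
      simpa using hi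
  set 𝓕 := hyperfilter ℕ
  have h𝓕 : (𝓕 : Filter ℕ) ≤ atTop := Nat.hyperfilter_le_atTop
  have hcomp : ∀ u : ℕ → ℝ, (∀ n, 0 ≤ u n) → (∀ n, u n ≤ M) →
      ∃ x, Tendsto u 𝓕 (𝓝 x) := by
    intro u h0 h1
    obtain ⟨x, -, hx⟩ := (isCompact_Icc (a := (0 : ℝ)) (b := M)).ultrafilter_le_nhds (𝓕.map u)
      (by
        rw [le_principal_iff]
        exact Ultrafilter.mem_map.2 (univ_mem' fun n => ⟨h0 n, h1 n⟩))
    exact ⟨x, hx⟩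
  choose g hg using fun j => hcomp (fun n => γ n j) (fun n => hγ n j) fun n => by
    refine (hdec' n j).trans (div_le_self hM0 ?_)
    linarith [(Nat.cast_nonneg j : (0 : ℝ) ≤ j)]
  obtain ⟨s, hs⟩ := hcomp S hSnn hM
  have hgnn : ∀ j, 0 ≤ g j := fun j => ge_of_tendsto' (hg j) fun n => hγ n j
  have hgpart : ∀ k, ∑ j ∈ Finset.range k, g j ≤ s := fun k =>
    le_of_tendsto_of_tendsto' (tendsto_finsetSum _ fun j _ => hg j) hs fun n => hpart n k
  have hgs : Summable g := summable_of_sum_range_le hgnn hgpart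
  refine ⟨s - ∑' j, g j, g, sub_nonneg.2 (hgs.tsum_le_of_sum_range_le hgpart), hgnn, hgs,
    fun w => ?_⟩
  have hexp : ∀ x : ℝ, 0 ≤ x → x ≤ M →
      ‖(1 + (x : ℂ) * w) * Complex.exp (-(x * w)) - 1‖ ≤
        x ^ 2 * (‖w‖ ^ 2 * Real.exp (2 * (M * ‖w‖))) := by
    intro x hx hxM
    have h1 : (1 + (x : ℂ) * w) * Complex.exp (-(x * w)) - 1 =
        -(Complex.exp (-(x * w)) * (Complex.exp (x * w) - 1 - x * w)) := by
      have : Complex.exp (-(x * w)) * Complex.exp (x * w) = 1 := by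
        rw [← Complex.exp_add]; simp
      linear_combination this
    have hn : ‖(x : ℂ) * w‖ = x * ‖w‖ := by rw [norm_mul, Complex.norm_of_nonneg hx]
    have hle : x * ‖w‖ ≤ M * ‖w‖ := by gcongr
    have h2 : ‖Complex.exp (-(x * w))‖ ≤ Real.exp (M * ‖w‖) :=
      (Complex.norm_exp_le_exp_norm _).trans (by rw [norm_neg, hn]; gcongr)
    have h3 : ‖Complex.exp (x * w) - 1 - x * w‖ ≤ (x * ‖w‖) ^ 2 * Real.exp (M * ‖w‖) := by
      have := Complex.norm_exp_sub_sum_le_norm_mul_exp (x * w) 2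
      rw [hn] at this
      simp only [Finset.sum_range_succ, Finset.range_zero, Finset.sum_empty, pow_zero,
        Nat.factorial_zero, Nat.cast_one, div_one, zero_add, pow_one, Nat.factorial_one] at this
      rw [← sub_sub] at this
      exact this.trans (by gcongr)
    rw [h1, norm_neg, norm_mul]
    calc _ ≤ Real.exp (M * ‖w‖) * ((x * ‖w‖) ^ 2 * Real.exp (M * ‖w‖)) := by gcongr
      _ = _ := by rw [two_mul, Real.exp_add]; ring
  have hbound : Summable fun j : ℕ =>
      (M / (j + 1)) ^ 2 * (‖w‖ ^ 2 * Real.exp (2 * (M * ‖w‖))) := by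
    refine Summable.mul_right _ ?_
    have := ((summable_nat_add_iff 1).2
      (Real.summable_one_div_nat_pow.2 one_lt_two)).mul_left (M ^ 2)
    refine this.congr fun j => ?_
    push_cast
    field_simp
  have hT := tendsto_tprod_one_add_of_dominated_convergence (𝓕 := (𝓕 : Filter ℕ))
    (f := fun n j => (1 + (γ n j : ℂ) * w) * Complex.exp (-(γ n j * w)) - 1)
    (g := fun j => (1 + (g j : ℂ) * w) * Complex.exp (-(g j * w)) - 1) hbound
    (fun j => by
      have h : Continuous fun x : ℝ => (1 + (x : ℂ) * w) * Complex.exp (-(x * w)) - 1 := by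
        fun_prop
      exact (h.tendsto (g j)).comp (hg j))
    (Eventually.of_forall fun n j => (hexp _ (hγ n j) ((hdec' n j).trans (div_le_self hM0
      (by linarith [(Nat.cast_nonneg j : (0 : ℝ) ≤ j)])))).trans (by
        have := hγ n j
        have := hdec' n j
        gcongr))
  simp only [add_sub_cancel] at hT
  have hL : ∀ n, ∏' j, ((1 + (γ n j : ℂ) * w) * Complex.exp (-(γ n j * w))) =
      (∏ j ∈ Finset.range (N n), (1 + (γ n j : ℂ) * w)) * Complex.exp (-(S n * w)) := by
    intro n
    rw [tprod_eq_prod (s := Finset.range (N n)) (fun j hj => by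
      rw [hγ0 n j (by simpa using hj)]; simp), Finset.prod_mul_distrib, ← Complex.exp_sum]
    congr 2
    rw [Finset.sum_neg_distrib, ← Finset.sum_mul, hS]
    push_cast
    rfl
  simp only [hL] at hT
  have hT' : Tendsto (fun n => (∏ j ∈ Finset.range (N n), (1 + (γ n j : ℂ) * w)) *
      Complex.exp (-(S n * w))) 𝓕 (𝓝 (f w / c * Complex.exp (-(s * w)))) := by
    refine ((hratio w).mono_left h𝓕).mul ?_
    have h : Continuous fun x : ℝ => Complex.exp (-((x : ℂ) * w)) := by fun_prop
    exact (h.tendsto s).comp hs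
  have heq := tendsto_nhds_unique hT' hT
  have hgw : Summable fun j => (g j : ℂ) * w := (Complex.summable_ofReal.2 hgs).mul_right w
  have hR : ∏' j, ((1 + (g j : ℂ) * w) * Complex.exp (-(g j * w))) =
      (∏' j, (1 + (g j : ℂ) * w)) * Complex.exp (-((∑' j, g j : ℝ) * w)) := by
    have h1 := (Complex.multipliable_one_add_of_summable hgw).hasProd
    have h2 := hgw.neg.hasSum.cexp
    refine (h1.mul h2).tprod_eq.trans ?_
    rw [tsum_neg, tsum_mul_right, Complex.ofReal_tsum]
  rw [hR] at heq
  have hc' : (c : ℂ) ≠ 0 := by exact_mod_cast hc.ne'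
  have e1 : Complex.exp (-(s * w)) * Complex.exp (s * w) = 1 := by
    rw [← Complex.exp_add]; simp
  have e2 : Complex.exp (((s - ∑' j, g j : ℝ) : ℂ) * w) =
      Complex.exp (-((∑' j, g j : ℝ) * w)) * Complex.exp (s * w) := by
    rw [← Complex.exp_add]; congr 1; push_cast; ring
  rw [e2]
  have h3 : f w = c * (f w / c * Complex.exp (-(s * w))) * Complex.exp (s * w) := by
    field_simp
    linear_combination (-f w) * e1
  rw [h3, heq]
  ring

/-- A function in the Laguerre–Pólya class with negative zeros which grows slower than every
exponential on the positive axis is a genus zero canonical product. -/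
lemma exists_prod (hf : LaguerrePolya f) {c : ℝ} (hc : 0 < c) (hf0 : f 0 = c)
    (hgrow : ∀ δ : ℝ, 0 < δ → ∃ K : ℝ, ∀ x : ℝ, 0 ≤ x → ‖f x‖ ≤ K * Real.exp (δ * x)) :
    ∃ γ : ℕ → ℝ, (∀ j, 0 ≤ γ j) ∧ Summable γ ∧ ∀ w, f w = c * ∏' j, (1 + (γ j : ℂ) * w) := by
  obtain ⟨α, γ, hα, hγ, hs, hprod⟩ := hf.exists_prod_exp hc hf0
  suffices α = 0 by
    refine ⟨γ, hγ, hs, fun w => ?_⟩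
    rw [hprod w, this]
    simp
  by_contra hne
  have hα' : 0 < α := lt_of_le_of_ne hα (Ne.symm hne)
  obtain ⟨K, hK⟩ := hgrow (α / 2) (half_pos hα')
  have hone : ∀ x : ℝ, 0 ≤ x → 1 ≤ ‖∏' j, (1 + (γ j : ℂ) * x)‖ := by
    intro x hx
    have h1 := (Complex.multipliable_one_add_of_summable
      ((Complex.summable_ofReal.2 hs).mul_right (x : ℂ))).hasProd
    refine ge_of_tendsto' ((continuous_norm.tendsto _).comp h1) fun t => ?_
    rw [Function.comp_apply, norm_prod]
    refine Finset.one_le_prod fun j _ => ?_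
    have : 0 ≤ γ j * x := mul_nonneg (hγ j) hx
    rw [show (1 : ℂ) + γ j * x = ((1 + γ j * x : ℝ) : ℂ) by push_cast; ring,
      Complex.norm_of_nonneg (by linarith)]
    linarith
  have hle : ∀ x : ℝ, 0 ≤ x → c * Real.exp (α / 2 * x) ≤ K := by
    intro x hx
    have h1 := hK x hx
    rw [hprod, norm_mul, norm_mul, Complex.norm_of_nonneg hc.le, ← Complex.ofReal_mul,
      ← Complex.ofReal_exp, Complex.norm_of_nonneg (Real.exp_pos _).le] at h1
    have h2 : c * Real.exp (α * x) ≤ K * Real.exp (α / 2 * x) :=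
      (le_mul_of_one_le_right (by positivity) (hone x hx)).trans h1
    have h3 : Real.exp (α * x) = Real.exp (α / 2 * x) * Real.exp (α / 2 * x) := by
      rw [← Real.exp_add]; congr 1; ring
    rw [h3, ← mul_assoc] at h2
    exact le_of_mul_le_mul_right h2 (Real.exp_pos _)
  have hx : 0 ≤ |K| / c * (2 / α) := by positivity
  have h1 := hle _ hx
  have h2 := Real.add_one_le_exp (α / 2 * (|K| / c * (2 / α)))
  have h3 : α / 2 * (|K| / c * (2 / α)) = |K| / c := by field_simp
  rw [h3] at h1 h2
  have h4 : c * (|K| / c + 1) = |K| + c := by field_simp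
  nlinarith [le_abs_self K, mul_le_mul_of_nonneg_left h2 hc.le]

end LaguerrePolya

section

lemma norm_term_le {c : ℕ → ℝ} (hc : ∀ n, |c n| ≤ 1 / (n.factorial : ℝ)) (w : ℂ) (n : ℕ) :
    ‖(c n : ℂ) * w ^ n‖ ≤ ‖w‖ ^ n / n.factorial := by
  rw [norm_mul, Complex.norm_real, Real.norm_eq_abs, norm_pow, div_eq_mul_one_div, mul_comm]
  gcongr
  exact hc n

lemma summable_term {c : ℕ → ℝ} (hc : ∀ n, |c n| ≤ 1 / (n.factorial : ℝ)) (w : ℂ) :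
    Summable fun n => (c n : ℂ) * w ^ n :=
  Summable.of_norm_bounded (Real.summable_pow_div_factorial ‖w‖) (norm_term_le hc w)

lemma abs_shift_le {c : ℕ → ℝ} (hc : ∀ n, |c n| ≤ 1 / (n.factorial : ℝ)) (n : ℕ) :
    |((n : ℝ) + 1) * c (n + 1)| ≤ 1 / (n.factorial : ℝ) := by
  have h := hc (n + 1)
  rw [Nat.factorial_succ, Nat.cast_mul, ← div_div] at h
  rw [abs_mul, abs_of_pos (by positivity : (0 : ℝ) < n + 1)]
  calc (n + 1 : ℝ) * |c (n + 1)| ≤ (n + 1) * (1 / ((n + 1 : ℕ) : ℝ) / n.factorial) := by gcongr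
    _ = _ := by push_cast; field_simp

lemma hasDerivAt_tsum_pow {c : ℕ → ℝ} (hc : ∀ n, |c n| ≤ 1 / (n.factorial : ℝ)) (w : ℂ) :
    HasDerivAt (fun w : ℂ => ∑' n, (c n : ℂ) * w ^ n)
      (∑' n : ℕ, ((((n : ℝ) + 1) * c (n + 1) : ℝ) : ℂ) * w ^ n) w := by
  have hshift : ∀ w : ℂ, ∑' n : ℕ, ((((n : ℝ) + 1) * c (n + 1) : ℝ) : ℂ) * w ^ n =
      ∑' n : ℕ, (c n : ℂ) * (n * w ^ (n - 1)) := by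
    intro w
    have hs := summable_term (abs_shift_le hc) w
    rw [tsum_eq_zero_add' (f := fun n : ℕ => (c n : ℂ) * (n * w ^ (n - 1)))]
    · simp only [CharP.cast_eq_zero, zero_mul, mul_zero, zero_add]
      refine tsum_congr fun n => ?_
      push_cast [Nat.add_sub_cancel]
      ring
    · refine hs.congr fun n => ?_
      push_cast [Nat.add_sub_cancel]
      ring
  rw [hshift]
  set R := ‖w‖ + 1
  have hu : Summable fun n : ℕ => R ^ (n - 1) / (n - 1).factorial := by
    refine (summable_nat_add_iff 1).1 ?_
    simpa using Real.summable_pow_div_factorial R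
  refine hasDerivAt_tsum_of_isPreconnected (t := Metric.ball 0 R) (y₀ := 0)
    (g := fun n w => (c n : ℂ) * w ^ n) (g' := fun n w => (c n : ℂ) * (n * w ^ (n - 1)))
    hu Metric.isOpen_ball
    (convex_ball _ _).isPreconnected (fun n y _ => (hasDerivAt_pow n y).const_mul _)
    (fun n y hy => ?_) (by simp [R]; positivity) (summable_term hc 0) (by simp [R])
  have hy' : ‖y‖ ≤ R := by simpa using (Metric.mem_ball.1 hy).le
  rcases n with _ | n
  · simp
  · have := norm_term_le (abs_shift_le hc) y n
    push_cast [Nat.add_sub_cancel] at this ⊢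
    calc _ = ‖((n : ℂ) + 1) * c (n + 1) * y ^ n‖ := by congr 1; ring
      _ ≤ _ := this
      _ ≤ _ := by gcongr

/-- Taylor coefficients of the entire solution of `4 w ∂²B + 2 D ∂B = B` with `B 0 = 1`. -/
def besselCoeff (D : ℕ) : ℕ → ℝ
  | 0 => 1
  | n + 1 => besselCoeff D n / ((n + 1) * (4 * n + 2 * D))

/-- The spherical average of `exp (z · u)` over the unit sphere of `ℝ^D`, as a function of
`w = z · z`. -/
def bessel (D : ℕ) (w : ℂ) : ℂ := ∑' n, (besselCoeff D n : ℂ) * w ^ n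

variable {D : ℕ}

lemma besselCoeff_pos (hD : 0 < D) (n : ℕ) : 0 < besselCoeff D n := by
  induction n with
  | zero => exact one_pos
  | succ n ih =>
    have : (0 : ℝ) < D := by exact_mod_cast hD
    rw [besselCoeff]; positivity

lemma besselCoeff_le (hD : 0 < D) (n : ℕ) :
    besselCoeff D n ≤ 1 / ((2 * n).factorial : ℝ) := by
  induction n with
  | zero => simp [besselCoeff]
  | succ n ih =>
    have : (1 : ℝ) ≤ D := by exact_mod_cast hD
    rw [besselCoeff, show 2 * (n + 1) = 2 * n + 1 + 1 by ring, Nat.factorial_succ,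
      Nat.factorial_succ]
    push_cast
    calc besselCoeff D n / ((n + 1) * (4 * n + 2 * D))
        ≤ (1 / ((2 * n).factorial : ℝ)) / ((n + 1) * (4 * n + 2 * 1)) := by gcongr
      _ = _ := by field_simp; ring

lemma abs_besselCoeff_le (hD : 0 < D) (n : ℕ) : |besselCoeff D n| ≤ 1 / (n.factorial : ℝ) := by
  rw [abs_of_pos (besselCoeff_pos hD n)]
  refine (besselCoeff_le hD n).trans ?_
  have : (n.factorial : ℝ) ≤ (2 * n).factorial := by
    exact_mod_cast Nat.factorial_le (by omega)
  gcongr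

lemma hasDerivAt_bessel (hD : 0 < D) (w : ℂ) :
    HasDerivAt (bessel D) (∑' n : ℕ, ((((n : ℝ) + 1) * besselCoeff D (n + 1) : ℝ) : ℂ) * w ^ n) w :=
  hasDerivAt_tsum_pow (abs_besselCoeff_le hD) w

lemma differentiable_bessel (hD : 0 < D) : Differentiable ℂ (bessel D) :=
  fun w => (hasDerivAt_bessel hD w).differentiableAt

lemma bessel_zero : bessel D 0 = 1 := by
  rw [bessel, tsum_eq_single 0 fun n hn => by simp [hn]]
  simp [besselCoeff]

lemma bessel_ode (hD : 0 < D) (w : ℂ) :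
    4 * w * deriv (deriv (bessel D)) w + 2 * D * deriv (bessel D) w = bessel D w := by
  have hc := abs_besselCoeff_le hD
  have h1 : deriv (bessel D) =
      fun w => ∑' n : ℕ, ((((n : ℝ) + 1) * besselCoeff D (n + 1) : ℝ) : ℂ) * w ^ n :=
    funext fun w => (hasDerivAt_bessel hD w).deriv
  have h2 := (hasDerivAt_tsum_pow (abs_shift_le hc) w).deriv
  rw [h1, h2]
  have hs1 := (summable_term (abs_shift_le hc) w).hasSum
  have hs2 := (summable_term (abs_shift_le (abs_shift_le hc)) w).hasSum
  have hs3 := hs2.mul_left (4 * w)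
  have hs4 : HasSum (fun n : ℕ => 4 * w * ((n * ((n + 1) * besselCoeff D (n + 1))) * w ^ (n - 1)))
      (4 * w * ∑' n : ℕ, ((((n : ℝ) + 1) * ((((n + 1 : ℕ) : ℝ) + 1) *
        besselCoeff D (n + 1 + 1)) : ℝ) : ℂ) * w ^ n) := by
    rw [← hasSum_nat_add_iff' 1]
    simp only [Finset.sum_range_one, Nat.cast_zero, zero_mul, mul_zero, sub_zero]
    refine hs3.congr_fun ?_
    intro n
    push_cast [Nat.add_sub_cancel]
    rfl
  refine (hs4.add (hs1.mul_left (2 * (D : ℂ)))).tsum_eq.symm.trans (tsum_congr fun n => ?_)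
  have hD' : (D : ℂ) ≠ 0 := by exact_mod_cast hD.ne'
  have e : ((n : ℂ) + 1) * besselCoeff D (n + 1) * (4 * n + 2 * D) = besselCoeff D n := by
    have : (0 : ℝ) < D := by exact_mod_cast hD
    have : ((n : ℝ) + 1) * besselCoeff D (n + 1) * (4 * n + 2 * D) = besselCoeff D n := by
      rw [besselCoeff]; field_simp
    exact_mod_cast this
  rw [← e]
  rcases n with _ | n
  · simp; ring
  · rw [Nat.add_sub_cancel]; push_cast; ring

lemma norm_bessel_le (hD : 0 < D) (w : ℂ) : ‖bessel D w‖ ≤ Real.exp √‖w‖ := by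
  have h := Real.hasSum_cosh √‖w‖
  have hle : Real.cosh √‖w‖ ≤ Real.exp √‖w‖ := by
    rw [Real.cosh_eq]
    have : Real.exp (-√‖w‖) ≤ Real.exp √‖w‖ :=
      Real.exp_le_exp.2 (by linarith [Real.sqrt_nonneg ‖w‖])
    linarith
  refine (tsum_of_norm_bounded h fun n => ?_).trans hle
  rw [norm_mul, Complex.norm_of_nonneg (besselCoeff_pos hD n).le, norm_pow, pow_mul,
    Real.sq_sqrt (norm_nonneg _), div_eq_mul_one_div, mul_comm]
  gcongr
  exact besselCoeff_le hD n

/-- Laguerre polynomials, normalised so that their coefficients are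
`n.descFactorial k * besselCoeff D k`. -/
def laguerre (D : ℕ) : ℕ → ℝ[X]
  | 0 => 1
  | n + 1 => C (1 / (n + D / 2 : ℝ)) *
      (X * derivative (laguerre D n) + (C (n + D / 2 : ℝ) + C (1 / 4) * X) * laguerre D n)

lemma laguerre_negRooted (hD : 0 < D) (n : ℕ) : NegRooted (laguerre D n) := by
  have : (0 : ℝ) < D := by exact_mod_cast hD
  induction n with
  | zero => exact NegRooted.one
  | succ n ih => exact (ih.laguerreStep (by positivity) (by norm_num)).C_mul (by positivity)

lemma laguerre_coeff (hD : 0 < D) (n k : ℕ) :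
    (laguerre D n).coeff k = n.descFactorial k * besselCoeff D k := by
  have hD' : (0 : ℝ) < D := by exact_mod_cast hD
  induction n generalizing k with
  | zero => rcases k with _ | k <;> simp [laguerre, besselCoeff, coeff_one]
  | succ n ih =>
    rw [laguerre, coeff_C_mul, add_mul, coeff_add, coeff_add, coeff_C_mul, mul_assoc (C (1 / 4)),
      coeff_C_mul]
    rcases k with _ | k
    · simp only [mul_coeff_zero, coeff_X_zero, zero_mul, ih]
      simp [besselCoeff]
      field_simp
    · rw [coeff_X_mul, coeff_X_mul, coeff_derivative, ih, ih, Nat.succ_descFactorial_succ]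
      have hd : (n.descFactorial (k + 1) : ℝ) = ((n : ℝ) - k) * n.descFactorial k := by
        rcases le_or_gt k n with h | h
        · rw [Nat.descFactorial_succ]; push_cast [Nat.cast_sub h]; ring
        · rw [Nat.descFactorial_of_lt h, Nat.descFactorial_of_lt (by omega)]; simp
      have hb : besselCoeff D k = (k + 1) * (4 * k + 2 * D) * besselCoeff D (k + 1) := by
        rw [besselCoeff]; field_simp
      rw [hd, hb]
      push_cast
      field_simp
      ring

lemma tendsto_descFactorial_div_pow (k : ℕ) :
    Tendsto (fun n : ℕ => (n.descFactorial k : ℝ) / n ^ k) atTop (𝓝 1) := by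
  induction k with
  | zero => simp
  | succ k ih =>
    have h1 : Tendsto (fun n : ℕ => 1 - (k : ℝ) / n) atTop (𝓝 (1 - 0)) :=
      tendsto_const_nhds.sub (tendsto_const_div_atTop_nhds_zero_nat _)
    have := h1.mul ih
    simp only [sub_zero, mul_one] at this
    refine this.congr' ?_
    filter_upwards [eventually_gt_atTop k] with n hn
    have : (n : ℝ) ≠ 0 := by exact_mod_cast (by omega : n ≠ 0)
    rw [Nat.descFactorial_succ, Nat.cast_mul, Nat.cast_sub hn.le]
    field_simp
    ring

lemma laguerrePolya_bessel (hD : 0 < D) : LaguerrePolya (bessel D) := by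
  refine ⟨differentiable_bessel hD, fun R ε hε => ?_⟩
  set a : ℕ → ℕ → ℝ := fun n k => (n.descFactorial k : ℝ) / n ^ k with ha
  have ha0 : ∀ n k, 0 ≤ a n k := fun n k => by positivity
  have ha1 : ∀ n k, a n k ≤ 1 := fun n k =>
    div_le_one_of_le₀ (by exact_mod_cast Nat.descFactorial_le_pow n k) (by positivity)
  have hb := besselCoeff_pos hD
  have hbound : Summable fun k => besselCoeff D k * |R| ^ k := by
    refine Summable.of_nonneg_of_le (fun k => mul_nonneg (hb k).le (by positivity)) (fun k => ?_)
      (Real.summable_pow_div_factorial |R|)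
    rw [div_eq_mul_one_div, mul_comm]
    gcongr
    exact (le_abs_self _).trans (abs_besselCoeff_le hD k)
  have hle : ∀ n k, ‖(1 - a n k) * (besselCoeff D k * |R| ^ k)‖ ≤ besselCoeff D k * |R| ^ k := by
    intro n k
    have h1 : 0 ≤ besselCoeff D k * |R| ^ k := mul_nonneg (hb k).le (by positivity)
    rw [Real.norm_of_nonneg (mul_nonneg (by linarith [ha1 n k]) h1)]
    exact mul_le_of_le_one_left h1 (by linarith [ha0 n k])
  have hT : Tendsto (fun n => ∑' k, (1 - a n k) * (besselCoeff D k * |R| ^ k)) atTop (𝓝 0) := by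
    have := tendsto_tsum_of_dominated_convergence (𝓕 := atTop)
      (f := fun n k => (1 - a n k) * (besselCoeff D k * |R| ^ k)) (g := fun _ => 0) hbound
      (fun k => by
        have := ((tendsto_descFactorial_div_pow k).const_sub 1).mul_const
          (besselCoeff D k * |R| ^ k)
        simpa using this) (Eventually.of_forall fun n k => hle n k)
    simpa using this
  obtain ⟨n, hn, hn1⟩ := ((hT.eventually_le_const hε).and (eventually_ge_atTop 1)).exists
  have hn0 : (0 : ℝ) < n := by exact_mod_cast hn1
  refine ⟨_, (laguerre_negRooted hD n).scale (inv_pos.2 hn0), fun w hw => ?_⟩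
  have hw' : ‖w‖ ≤ |R| := hw.trans (le_abs_self R)
  set q := (laguerre D n).comp (C (n : ℝ)⁻¹ * X)
  have hq : ∀ k, q.coeff k = a n k * besselCoeff D k := fun k => by
    rw [comp_C_mul_X_coeff, laguerre_coeff hD, ha]
    simp only [inv_pow]
    ring
  have hqs : HasSum (fun k => (q.coeff k : ℂ) * w ^ k) (aeval w q) := by
    rw [aeval_eq_sum_range]
    have := hasSum_sum_of_ne_finset_zero (L := .unconditional ℕ)
      (s := Finset.range (q.natDegree + 1))
      (f := fun k => (q.coeff k : ℂ) * w ^ k) (fun k hk => by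
        rw [coeff_eq_zero_of_natDegree_lt (by simpa [Nat.lt_succ_iff] using hk)]; simp)
    simpa using this
  have hbs := (summable_term (abs_besselCoeff_le hD) w).hasSum
  have hdiff := hbs.sub hqs
  rw [bessel, ← hdiff.tsum_eq]
  refine le_trans (tsum_of_norm_bounded
    (Summable.of_norm_bounded hbound (hle n)).hasSum fun k => ?_) hn
  rw [hq, ← sub_mul, norm_mul, norm_pow, ← Complex.ofReal_sub, Complex.norm_real,
    Real.norm_eq_abs, ← one_sub_mul, abs_mul, abs_of_pos (hb k),
    abs_of_nonneg (sub_nonneg.2 (ha1 n k)), mul_assoc]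
  have := ha1 n k
  have := (hb k).le
  gcongr

end

section

lemma hasDerivAt_integral_dilation {g : ℂ → ℂ} (hg : Differentiable ℂ g) {p : ℝ → ℝ}
    (hp : Continuous p) (R : ℝ) (w : ℂ) :
    HasDerivAt (fun w : ℂ => ∫ r in (0 : ℝ)..R, (p r : ℂ) * g (w * r ^ 2))
      (∫ r in (0 : ℝ)..R, ((p r * r ^ 2 : ℝ) : ℂ) * deriv g (w * r ^ 2)) w := by
  have hg' : Continuous (deriv g) := (LaguerrePolya.differentiable_deriv hg).continuous
  have hF : Continuous fun x : ℂ × ℝ => ((p x.2 * x.2 ^ 2 : ℝ) : ℂ) * deriv g (x.1 * x.2 ^ 2) := by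
    fun_prop
  have hcont := hg.continuous
  obtain ⟨M, hM⟩ := ((isCompact_closedBall w 1).prod
    (isCompact_uIcc (a := (0 : ℝ)) (b := R))).exists_bound_of_continuousOn hF.continuousOn
  refine (intervalIntegral.hasDerivAt_integral_of_dominated_loc_of_deriv_le
    (F := fun (w : ℂ) (r : ℝ) => (p r : ℂ) * g (w * r ^ 2))
    (F' := fun (w : ℂ) (r : ℝ) => ((p r * r ^ 2 : ℝ) : ℂ) * deriv g (w * r ^ 2))
    (bound := fun _ => M) (Metric.ball_mem_nhds w one_pos) ?_ ?_ ?_ ?_ ?_ ?_).2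
  · exact Eventually.of_forall fun x => (by fun_prop : Continuous _).aestronglyMeasurable
  · exact (by fun_prop : Continuous _).intervalIntegrable _ _
  · exact (by fun_prop : Continuous _).aestronglyMeasurable
  · exact Eventually.of_forall fun r hr x hx =>
      hM (x, r) ⟨Metric.ball_subset_closedBall hx, Set.uIoc_subset_uIcc hr⟩
  · exact intervalIntegrable_const
  · refine Eventually.of_forall fun r _ x _ => ?_
    have h1 : HasDerivAt (fun x : ℂ => x * (r : ℂ) ^ 2) ((r : ℂ) ^ 2) x := by
      simpa using (hasDerivAt_id x).mul_const ((r : ℂ) ^ 2)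
    refine (((hg (x * r ^ 2)).hasDerivAt.comp x h1).const_mul (p r : ℂ)).congr_deriv ?_
    push_cast
    ring

/-- The transform of the measure on the ball of radius `R` in `ℝ^D` with radial density `p`,
up to the area of the sphere, as a function of `w = z · z`. -/
def radial (D : ℕ) (R : ℝ) (p : ℝ → ℝ) (w : ℂ) : ℂ :=
  ∫ r in (0 : ℝ)..R, ((p r * r ^ (D - 1) : ℝ) : ℂ) * bessel D (w * r ^ 2)

variable {D : ℕ} {R : ℝ} {p : ℝ → ℝ}

lemma deriv_radial (hD : 0 < D) (hp : Continuous p) :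
    deriv (radial D R p) = fun w =>
      ∫ r in (0 : ℝ)..R, ((p r * r ^ (D - 1) * r ^ 2 : ℝ) : ℂ) * deriv (bessel D) (w * r ^ 2) :=
  funext fun w => (hasDerivAt_integral_dilation (differentiable_bessel hD)
    (p := fun r => p r * r ^ (D - 1)) (by fun_prop) R w).deriv

lemma besselOp_radial (hD : 0 < D) (hp : Continuous p) (μ ν : ℝ) (w : ℂ) :
    μ * radial D R p w + ν * (4 * w * deriv (deriv (radial D R p)) w
      + 2 * D * deriv (radial D R p) w) = radial D R (fun r => (μ + ν * r ^ 2) * p r) w := by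
  have hB := differentiable_bessel hD
  have hB' := LaguerrePolya.differentiable_deriv hB
  have h0 := hB.continuous
  have h1 := hB'.continuous
  have h2 := (LaguerrePolya.differentiable_deriv hB').continuous
  rw [deriv_radial hD hp, (hasDerivAt_integral_dilation hB'
    (p := fun r => p r * r ^ (D - 1) * r ^ 2) (by fun_prop) R w).deriv, radial, radial]
  simp only [← intervalIntegral.integral_const_mul]
  rw [← intervalIntegral.integral_add, ← intervalIntegral.integral_const_mul,
    ← intervalIntegral.integral_add]
  · refine intervalIntegral.integral_congr fun r _ => ?_
    rw [← bessel_ode hD (w * r ^ 2)]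
    push_cast
    ring
  all_goals exact (by fun_prop : Continuous _).intervalIntegrable _ _

lemma laguerrePolya_radial_mul (hD : 0 < D) (hp : Continuous p) {μ ν : ℝ} (hμ : 0 < μ)
    (hν : 0 ≤ ν) (h : LaguerrePolya (radial D R p)) :
    LaguerrePolya (radial D R fun r => (μ + ν * r ^ 2) * p r) := by
  have := h.besselOp hμ hν D
  rwa [funext (besselOp_radial hD hp μ ν)] at this

lemma laguerrePolya_radial_mul_pow (hD : 0 < D) (hp : Continuous p) {μ ν : ℝ} (hμ : 0 < μ)
    (hν : 0 ≤ ν) (h : LaguerrePolya (radial D R p)) (n : ℕ) :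
    LaguerrePolya (radial D R fun r => (μ + ν * r ^ 2) ^ n * p r) := by
  induction n with
  | zero => simpa using h
  | succ n ih =>
    simpa only [pow_succ', mul_assoc] using laguerrePolya_radial_mul hD (by fun_prop) hμ hν ih

lemma radial_eq_boundary_add (hD : 0 < D) {m : ℝ → ℝ} (hm : Continuous m)
    (hp : ∀ r, HasDerivAt p (-(m r * r)) r) (w : ℂ) :
    radial D R p w = 2 * p R * R ^ D * deriv (bessel D) (w * R ^ 2)
      + 2 * deriv (radial D R m) w := by
  have hB := differentiable_bessel hD
  have hB' := LaguerrePolya.differentiable_deriv hB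
  have h0 := hB.continuous
  have h1 := hB'.continuous
  have hpc : Continuous p := continuous_iff_continuousAt.2 fun r => (hp r).continuousAt
  have hu : ∀ r : ℝ, HasDerivAt (fun r : ℝ => 2 * ((r : ℂ) ^ D * deriv (bessel D) (w * r ^ 2)))
      ((r : ℂ) ^ (D - 1) * bessel D (w * r ^ 2)) r := by
    intro r
    have e1 : HasDerivAt (fun r : ℝ => (r : ℂ) ^ D) (D * (r : ℂ) ^ (D - 1)) r := by
      simpa using ((hasDerivAt_pow D (r : ℂ)).comp_ofReal)
    have e2 : HasDerivAt (fun r : ℝ => w * (r : ℂ) ^ 2) (w * (2 * r)) r := by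
      simpa using ((hasDerivAt_pow 2 (r : ℂ)).comp_ofReal).const_mul w
    have e3 := (hB' (w * r ^ 2)).hasDerivAt.comp r e2
    refine ((e1.mul e3).const_mul (2 : ℂ)).congr_deriv ?_
    rw [← bessel_ode hD (w * r ^ 2)]
    obtain ⟨d, rfl⟩ := Nat.exists_eq_add_of_lt hD
    simp only [zero_add, Nat.add_sub_cancel, pow_succ]
    push_cast
    simp only [Function.comp]
    ring
  have hpd : ∀ r : ℝ, HasDerivAt (fun r : ℝ => (p r : ℂ)) ((-(m r * r) : ℝ) : ℂ) r :=
    fun r => (hp r).ofReal_comp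
  have key := intervalIntegral.integral_mul_deriv_eq_deriv_mul (a := 0) (b := R)
    (fun r _ => hpd r) (fun r _ => hu r)
    ((by fun_prop : Continuous _).intervalIntegrable _ _)
    ((by fun_prop : Continuous _).intervalIntegrable _ _)
  rw [deriv_radial hD hm, radial]
  calc _ = ∫ r in (0 : ℝ)..R, (p r : ℂ) * ((r : ℂ) ^ (D - 1) * bessel D (w * r ^ 2)) := by
        refine intervalIntegral.integral_congr fun r _ => ?_
        push_cast
        ring
    _ = _ := by
        rw [key, sub_eq_add_neg, ← intervalIntegral.integral_neg]
        congr 1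
        · simp [hD.ne']; ring
        · rw [← intervalIntegral.integral_const_mul]
          refine intervalIntegral.integral_congr fun r _ => ?_
          obtain ⟨d, rfl⟩ := Nat.exists_eq_add_of_lt hD
          simp only [zero_add, Nat.add_sub_cancel, pow_succ]
          push_cast
          ring

lemma laguerrePolya_radial_cubic_pow (hD : 0 < D) (hR : 0 < R) {κ β : ℝ} (hκ : 0 < κ)
    (hβ : 0 < β) (hroot : 1 - κ * ((R ^ 2 + β) ^ 3 - β ^ 3) = 0) (n : ℕ) :
    LaguerrePolya (radial D R fun r => (1 - κ * ((r ^ 2 + β) ^ 3 - β ^ 3)) ^ n) := by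
  induction n with
  | zero =>
    have h := (((laguerrePolya_bessel hD).deriv.scale (t := R ^ 2) (by positivity)).const_mul
      (t := 2 * R ^ D) (by positivity))
    convert h using 2 with w
    have := radial_eq_boundary_add (R := R) hD (p := fun _ => 1) (m := fun _ => 0)
      continuous_const (fun r => by simpa using hasDerivAt_const r (1 : ℝ)) w
    have hz : radial D R (fun _ => 0) = fun _ => 0 := by ext w; simp [radial]
    simp only [pow_zero, this, hz]
    simp
  | succ n ih =>
    have h1 := laguerrePolya_radial_mul_pow hD (by fun_prop) hβ zero_le_one ih 2
    have h2 := h1.deriv.const_mul (t := 12 * κ * (n + 1)) (by positivity)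
    convert h2 using 2 with w
    set q : ℝ → ℝ := fun r => 1 - κ * ((r ^ 2 + β) ^ 3 - β ^ 3) with hq
    set m₀ : ℝ → ℝ := fun r => (β + 1 * r ^ 2) ^ 2 * q r ^ n with hm₀
    have hd : ∀ r, HasDerivAt (fun r => q r ^ (n + 1))
        (-((6 * κ * (n + 1) * m₀ r) * r)) r := by
      intro r
      have e := (((((((hasDerivAt_id r).pow 2).add_const β).pow 3).sub_const (β ^ 3)).const_mul
        κ).const_sub 1).pow (n + 1)
      refine e.congr_deriv ?_
      simp [hm₀, hq]
      ring
    have := radial_eq_boundary_add (R := R) hD (by fun_prop) hd w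
    rw [this]
    have hz : radial D R (fun r => 6 * κ * (n + 1) * m₀ r)
        = fun w => ((6 * κ * (n + 1) : ℝ) : ℂ) * radial D R m₀ w := by
      ext w
      rw [radial, radial, ← intervalIntegral.integral_const_mul]
      refine intervalIntegral.integral_congr fun r _ => ?_
      push_cast
      ring
    rw [hz, deriv_const_mul_field]
    simp only [hq, hroot]
    push_cast
    simp
    ring

end

section

/-- The sextic density `exp (-a r² - b r⁴ - c r⁶)`. -/
def sextic (a b c r : ℝ) : ℝ := Real.exp (-(a * r ^ 2 + b * (r ^ 2) ^ 2 + c * (r ^ 2) ^ 3))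

lemma continuous_sextic (a b c : ℝ) : Continuous (sextic a b c) := by
  unfold sextic; fun_prop

lemma sextic_mul_exp_le {b c : ℝ} (hb : 0 < b) (hc : 0 < c) (a M r : ℝ) :
    sextic a b c r * Real.exp (M * r) ≤
      Real.exp (M ^ 2 / 4 + (2 - a) ^ 2 / (4 * b)) * Real.exp (-1 * r ^ 2) := by
  rw [sextic, ← Real.exp_add, ← Real.exp_add]
  refine Real.exp_le_exp.2 ?_
  have h1 : M * r ≤ M ^ 2 / 4 + r ^ 2 := by nlinarith [sq_nonneg (M / 2 - r)]
  have h2 : (2 - a) * r ^ 2 - b * (r ^ 2) ^ 2 ≤ (2 - a) ^ 2 / (4 * b) := by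
    rw [le_div_iff₀ (by positivity)]
    nlinarith [sq_nonneg (2 * b * r ^ 2 - (2 - a))]
  have h3 : 0 ≤ c * (r ^ 2) ^ 3 := by positivity
  linarith

lemma integrableOn_pow_mul_exp_neg_sq (k : ℕ) :
    IntegrableOn (fun r : ℝ => r ^ k * Real.exp (-1 * r ^ 2)) (Set.Ioi 0) := by
  simpa only [Real.rpow_natCast] using integrableOn_rpow_mul_exp_neg_mul_sq one_pos
    (s := (k : ℝ)) (by linarith [(Nat.cast_nonneg k : (0 : ℝ) ≤ k)])

lemma integrableOn_sextic {b c : ℝ} (hb : 0 < b) (hc : 0 < c) (a M : ℝ) (k : ℕ) :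
    IntegrableOn (fun r => sextic a b c r * r ^ k * Real.exp (M * r)) (Set.Ioi 0) := by
  refine Integrable.mono' ((integrableOn_pow_mul_exp_neg_sq k).const_mul
    (Real.exp (M ^ 2 / 4 + (2 - a) ^ 2 / (4 * b)))) ?_ ?_
  · have := continuous_sextic a b c
    exact (by fun_prop : Continuous _).aestronglyMeasurable
  · filter_upwards [ae_restrict_mem measurableSet_Ioi] with r hr
    have hr' : (0 : ℝ) < r := hr
    have h0 : 0 ≤ sextic a b c r := (Real.exp_pos _).le
    rw [Real.norm_of_nonneg (by positivity)]
    calc sextic a b c r * r ^ k * Real.exp (M * r)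
        = r ^ k * (sextic a b c r * Real.exp (M * r)) := by ring
      _ ≤ r ^ k * _ := mul_le_mul_of_nonneg_left (sextic_mul_exp_le hb hc a M r) (by positivity)
      _ = _ := by ring

/-- The transform of the sextic measure, up to the area of the sphere, as a function of
`w = z · z`. -/
def sexticTransform (D : ℕ) (a b c : ℝ) (w : ℂ) : ℂ :=
  ∫ r in Set.Ioi (0 : ℝ), ((sextic a b c r * r ^ (D - 1) : ℝ) : ℂ) * bessel D (w * r ^ 2)

variable {D : ℕ}

lemma norm_bessel_mul_sq_le (hD : 0 < D) {w : ℂ} {M : ℝ} (hM : 0 ≤ M) (hw : ‖w‖ ≤ M ^ 2) {r : ℝ}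
    (hr : 0 ≤ r) : ‖bessel D (w * r ^ 2)‖ ≤ Real.exp (M * r) := by
  refine (norm_bessel_le hD _).trans (Real.exp_le_exp.2 (Real.sqrt_le_iff.2 ⟨by positivity, ?_⟩))
  rw [norm_mul, norm_pow, Complex.norm_real, Real.norm_of_nonneg hr, mul_pow]
  gcongr

lemma integrableOn_mul_bessel (hD : 0 < D) {p : ℝ → ℝ} (hp : Continuous p) {M : ℝ} (hM : 0 ≤ M)
    (hint : IntegrableOn (fun r => |p r| * Real.exp (M * r)) (Set.Ioi 0)) {w : ℂ}
    (hw : ‖w‖ ≤ M ^ 2) :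
    IntegrableOn (fun r => (p r : ℂ) * bessel D (w * r ^ 2)) (Set.Ioi 0) := by
  refine Integrable.mono' hint ?_ ?_
  · have := (differentiable_bessel hD).continuous
    exact (by fun_prop : Continuous _).aestronglyMeasurable
  · filter_upwards [ae_restrict_mem measurableSet_Ioi] with r hr
    rw [norm_mul, Complex.norm_real, Real.norm_eq_abs]
    gcongr
    exact norm_bessel_mul_sq_le hD hM hw (le_of_lt hr)

/-- Polynomial approximations, cut off at their first zero, of
`exp (l * r ^ 2 - c * ((r ^ 2 + β) ^ 3 - β ^ 3))`. -/
def cutoff (c l β : ℝ) (n : ℕ) (r : ℝ) : ℝ :=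
  (1 + l / n * r ^ 2) ^ n * max 0 (1 - c / n * ((r ^ 2 + β) ^ 3 - β ^ 3)) ^ n

lemma continuous_cutoff (c l β : ℝ) (n : ℕ) : Continuous (cutoff c l β n) := by
  unfold cutoff; fun_prop

lemma cutoff_nonneg {c l β : ℝ} (hl : 0 ≤ l) (n : ℕ) (r : ℝ) : 0 ≤ cutoff c l β n r := by
  unfold cutoff; positivity

lemma cutoff_le {c l β : ℝ} (hl : 0 ≤ l) {n : ℕ} (hn : n ≠ 0) (r : ℝ) :
    cutoff c l β n r ≤ Real.exp (l * r ^ 2 - c * ((r ^ 2 + β) ^ 3 - β ^ 3)) := by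
  have hn' : (n : ℝ) ≠ 0 := by exact_mod_cast hn
  set v := (r ^ 2 + β) ^ 3 - β ^ 3
  have h1 : 1 + l / n * r ^ 2 ≤ Real.exp (l / n * r ^ 2) := by
    linarith [Real.add_one_le_exp (l / n * r ^ 2)]
  have h2 : max 0 (1 - c / n * v) ≤ Real.exp (-(c / n * v)) :=
    max_le (Real.exp_pos _).le (by linarith [Real.add_one_le_exp (-(c / n * v))])
  calc cutoff c l β n r
      ≤ Real.exp (l / n * r ^ 2) ^ n * Real.exp (-(c / n * v)) ^ n := by
        unfold cutoff; gcongr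
    _ = _ := by
        rw [← Real.exp_nat_mul, ← Real.exp_nat_mul, ← Real.exp_add]
        congr 1
        field_simp
        ring

lemma tendsto_cutoff (c l β r : ℝ) : Tendsto (fun n => cutoff c l β n r) atTop
    (𝓝 (Real.exp (l * r ^ 2 - c * ((r ^ 2 + β) ^ 3 - β ^ 3)))) := by
  set v := (r ^ 2 + β) ^ 3 - β ^ 3 with hv
  have h1 := (Real.tendsto_one_add_div_pow_exp (l * r ^ 2)).mul
    (Real.tendsto_one_add_div_pow_exp (-(c * v)))
  rw [← Real.exp_add, ← sub_eq_add_neg] at h1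
  refine h1.congr' ?_
  filter_upwards [(tendsto_const_div_atTop_nhds_zero_nat (c * v)).eventually_le_const
    (zero_lt_one' ℝ)] with n hn
  rw [cutoff, ← hv, max_eq_right (by rw [div_mul_eq_mul_div]; linarith)]
  congr 2 <;> ring

lemma exists_radius {κ β : ℝ} (hκ : 0 < κ) (hβ : 0 < β) :
    ∃ R : ℝ, 0 < R ∧ 1 - κ * ((R ^ 2 + β) ^ 3 - β ^ 3) = 0 := by
  set f : ℝ → ℝ := fun R => 1 - κ * ((R ^ 2 + β) ^ 3 - β ^ 3) with hf
  set M := √(1 / (3 * κ * β ^ 2))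
  have hM : M ^ 2 = 1 / (3 * κ * β ^ 2) := Real.sq_sqrt (by positivity)
  have hfM : f M ≤ 0 := by
    have h1 : κ * (3 * β ^ 2 * M ^ 2) = 1 := by rw [hM]; field_simp
    have h2 : 0 ≤ κ * (M ^ 2 * M ^ 2 * M ^ 2 + 3 * β * (M ^ 2 * M ^ 2)) := by positivity
    simp only [hf]
    nlinarith
  obtain ⟨R, hR, hR0⟩ := intermediate_value_Icc' (a := 0) (b := M) (Real.sqrt_nonneg _)
    (f := f) (by fun_prop) ⟨hfM, by simp [hf]⟩
  refine ⟨R, hR.1.lt_of_ne ?_, hR0⟩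
  rintro rfl
  simp [hf] at hR0

lemma laguerrePolya_cutoff (hD : 0 < D) {c l β : ℝ} (hc : 0 < c) (hl : 0 ≤ l) (hβ : 0 < β) {n : ℕ}
    (hn : n ≠ 0) :
    LaguerrePolya fun w => ∫ r in Set.Ioi (0 : ℝ),
      ((cutoff c l β n r * r ^ (D - 1) : ℝ) : ℂ) * bessel D (w * r ^ 2) := by
  have hn' : (0 : ℝ) < n := by exact_mod_cast hn.bot_lt
  obtain ⟨R, hR, hroot⟩ := exists_radius (κ := c / n) (by positivity) hβ
  have h := laguerrePolya_radial_mul_pow hD (by fun_prop) one_pos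
    (div_nonneg hl hn'.le) (laguerrePolya_radial_cubic_pow hD hR (by positivity) hβ hroot n) n
  convert h using 2 with w
  rw [radial, intervalIntegral.integral_of_le hR.le]
  rw [setIntegral_eq_of_subset_of_forall_sdiff_eq_zero measurableSet_Ioi
    (Set.Ioc_subset_Ioi_self : Set.Ioc 0 R ⊆ Set.Ioi 0)]
  · refine setIntegral_congr_fun measurableSet_Ioc fun r hr => ?_
    have h1 : r ≤ R := hr.2
    have h0 : 0 ≤ r := hr.1.le
    have : c / n * ((r ^ 2 + β) ^ 3 - β ^ 3) ≤ c / n * ((R ^ 2 + β) ^ 3 - β ^ 3) := by gcongr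
    simp only [cutoff]
    rw [max_eq_right (by linarith)]
  · rintro r ⟨hr, hr2⟩
    have h1 : R ≤ r := by
      by_contra hlt
      exact hr2 ⟨hr, (not_le.1 hlt).le⟩
    have : c / n * ((R ^ 2 + β) ^ 3 - β ^ 3) ≤ c / n * ((r ^ 2 + β) ^ 3 - β ^ 3) := by gcongr
    rw [cutoff, max_eq_left (by linarith)]
    simp [hn]

lemma laguerrePolya_sexticTransform (hD : 0 < D) {a b c : ℝ} (hb : 0 < b) (hc : 0 < c)
    (ha : a ≤ b ^ 2 / (3 * c)) : LaguerrePolya (sexticTransform D a b c) := by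
  set l := b ^ 2 / (3 * c) - a with hl
  set β := b / (3 * c) with hβ
  have hl0 : 0 ≤ l := sub_nonneg.2 ha
  have hβ0 : 0 < β := by positivity
  have hdens : ∀ r : ℝ, Real.exp (l * r ^ 2 - c * ((r ^ 2 + β) ^ 3 - β ^ 3)) = sextic a b c r := by
    intro r
    rw [sextic, hl, hβ]
    congr 1
    field_simp
    ring
  have hs0 : ∀ r, 0 ≤ sextic a b c r := fun r => (Real.exp_pos _).le
  have hsc := continuous_sextic a b c
  refine LaguerrePolya.of_limit fun R ε hε => ?_
  set M := √|R|
  have hM : R ≤ M ^ 2 := (le_abs_self R).trans (Real.sq_sqrt (abs_nonneg R)).ge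
  have hint := integrableOn_sextic hb hc a M (D - 1)
  have hcut : ∀ n, n ≠ 0 → ∀ r, cutoff c l β n r ≤ sextic a b c r := fun n hn r =>
    (cutoff_le hl0 hn r).trans (hdens r).le
  have hcc := fun n => continuous_cutoff c l β n
  have hlim : Tendsto (fun n : ℕ => ∫ r in Set.Ioi (0 : ℝ),
      (sextic a b c r - cutoff c l β (n + 1) r) * r ^ (D - 1) * Real.exp (M * r)) atTop (𝓝 0) := by
    have := tendsto_integral_of_dominated_convergence (μ := volume.restrict (Set.Ioi (0 : ℝ)))
      (F := fun (n : ℕ) r =>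
        (sextic a b c r - cutoff c l β (n + 1) r) * r ^ (D - 1) * Real.exp (M * r))
      (f := fun _ => 0) _ (fun n => (by have := hcc (n + 1); fun_prop :
        Continuous _).aestronglyMeasurable) hint (fun n => ?_) (Eventually.of_forall fun r => ?_)
    · simpa using this
    · filter_upwards [ae_restrict_mem measurableSet_Ioi] with r hr
      have hr' : (0 : ℝ) < r := hr
      have h1 := hcut (n + 1) n.succ_ne_zero r
      have h2 := cutoff_nonneg (c := c) (β := β) hl0 (n + 1) r
      have h3 : 0 ≤ sextic a b c r - cutoff c l β (n + 1) r := sub_nonneg.2 h1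
      rw [Real.norm_of_nonneg (by positivity)]
      gcongr
      linarith
    · have := (((tendsto_cutoff c l β r).comp (tendsto_add_atTop_nat 1)).const_sub
        (sextic a b c r)).mul_const (r ^ (D - 1)) |>.mul_const (Real.exp (M * r))
      simpa [hdens] using this
  obtain ⟨n, hn⟩ := (hlim.eventually_le_const hε).exists
  refine ⟨_, laguerrePolya_cutoff hD hc hl0 hβ0 n.succ_ne_zero, fun w hw => ?_⟩
  have hM0 : 0 ≤ M := Real.sqrt_nonneg _
  have hcn := hcc (n + 1)
  rw [sexticTransform, ← integral_sub]
  · refine (norm_integral_le_of_norm_le (g := fun r => (sextic a b c r - cutoff c l β (n + 1) r) *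
      r ^ (D - 1) * Real.exp (M * r)) ?_ ?_).trans hn
    · refine Integrable.mono' hint (by fun_prop : Continuous _).aestronglyMeasurable ?_
      filter_upwards [ae_restrict_mem measurableSet_Ioi] with r hr
      have hr' : (0 : ℝ) < r := hr
      have h1 := hcut (n + 1) n.succ_ne_zero r
      have h2 := cutoff_nonneg (c := c) (β := β) hl0 (n + 1) r
      have h3 : 0 ≤ sextic a b c r - cutoff c l β (n + 1) r := sub_nonneg.2 h1
      rw [Real.norm_of_nonneg (by positivity)]
      gcongr
      linarith
    · filter_upwards [ae_restrict_mem measurableSet_Ioi] with r hr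
      have hr' : (0 : ℝ) < r := hr
      have h1 := hcut (n + 1) n.succ_ne_zero r
      have h3 : 0 ≤ sextic a b c r - cutoff c l β (n + 1) r := sub_nonneg.2 h1
      rw [← sub_mul, ← Complex.ofReal_sub, ← sub_mul, norm_mul, Complex.norm_real,
        Real.norm_of_nonneg (by positivity)]
      gcongr
      exact norm_bessel_mul_sq_le hD hM0 (hw.trans hM) hr'.le
  · refine integrableOn_mul_bessel hD (by fun_prop) hM0 ?_ (hw.trans hM)
    refine hint.congr_fun (fun r hr => ?_) measurableSet_Ioi
    have hr' : (0 : ℝ) < r := hr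
    simp only
    rw [abs_of_nonneg (mul_nonneg (hs0 r) (by positivity))]
  · refine integrableOn_mul_bessel hD (by fun_prop) hM0 ?_ (hw.trans hM)
    refine Integrable.mono' hint (by fun_prop : Continuous _).aestronglyMeasurable ?_
    filter_upwards [ae_restrict_mem measurableSet_Ioi] with r hr
    have hr' : (0 : ℝ) < r := hr
    have h1 := hcut (n + 1) n.succ_ne_zero r
    have h2 := cutoff_nonneg (c := c) (β := β) hl0 (n + 1) r
    rw [Real.norm_of_nonneg (by positivity), abs_of_nonneg (by positivity)]
    gcongr

lemma exists_prod_sexticTransform (hD : 0 < D) {a b c : ℝ} (hb : 0 < b) (hc : 0 < c)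
    (ha : a ≤ b ^ 2 / (3 * c)) :
    ∃ (C : ℝ) (γ : ℕ → ℝ), 0 < C ∧ (∀ j, 0 ≤ γ j) ∧ Summable γ ∧
      ∀ w, sexticTransform D a b c w = C * ∏' j, (1 + (γ j : ℂ) * w) := by
  set C := ∫ r in Set.Ioi (0 : ℝ), sextic a b c r * r ^ (D - 1) with hC
  have hC0 : sexticTransform D a b c 0 = (C : ℂ) := by
    simp only [sexticTransform, zero_mul, bessel_zero, mul_one]
    exact integral_ofReal
  have hCpos : 0 < C := by
    refine (setIntegral_pos_iff_support_of_nonneg_ae ?_ ?_).2 ?_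
    · filter_upwards [ae_restrict_mem measurableSet_Ioi] with r hr
      exact mul_nonneg (Real.exp_pos _).le (pow_nonneg (le_of_lt hr) _)
    · simpa using integrableOn_sextic hb hc a 0 (D - 1)
    · have : Set.Ioi (0 : ℝ) ⊆ Function.support fun r => sextic a b c r * r ^ (D - 1) :=
        fun r hr => (mul_pos (Real.exp_pos _) (pow_pos hr _)).ne'
      rw [Set.inter_eq_right.2 this]
      simp
  suffices hgrow : ∀ δ : ℝ, 0 < δ → ∃ K : ℝ, ∀ x : ℝ, 0 ≤ x →
      ‖sexticTransform D a b c x‖ ≤ K * Real.exp (δ * x) by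
    obtain ⟨γ, h0, hs, hp⟩ :=
      (laguerrePolya_sexticTransform hD hb hc ha).exists_prod hCpos hC0 hgrow
    exact ⟨C, γ, hCpos, h0, hs, hp⟩
  intro δ hδ
  have hint := integrableOn_sextic hb hc (a - 1 / (4 * δ)) 0 (D - 1)
  refine ⟨∫ r in Set.Ioi (0 : ℝ), sextic (a - 1 / (4 * δ)) b c r * r ^ (D - 1), fun x hx => ?_⟩
  rw [mul_comm, ← integral_const_mul]
  refine norm_integral_le_of_norm_le
    (Integrable.const_mul (by simpa [IntegrableOn] using hint) _) ?_
  filter_upwards [ae_restrict_mem measurableSet_Ioi] with r hr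
  have hr' : (0 : ℝ) < r := hr
  have hb' := norm_bessel_mul_sq_le hD (w := (x : ℂ)) (Real.sqrt_nonneg x)
    (by rw [Real.sq_sqrt hx, Complex.norm_of_nonneg hx]) hr'.le
  have hs0 : 0 ≤ sextic a b c r := (Real.exp_pos _).le
  rw [norm_mul, Complex.norm_of_nonneg (by positivity)]
  calc sextic a b c r * r ^ (D - 1) * ‖bessel D (x * r ^ 2)‖
      ≤ sextic a b c r * r ^ (D - 1) * Real.exp (√x * r) :=
        mul_le_mul_of_nonneg_left hb' (by positivity)
    _ = (sextic a b c r * Real.exp (√x * r)) * r ^ (D - 1) := by ring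
    _ ≤ (Real.exp (δ * x) * sextic (a - 1 / (4 * δ)) b c r) * r ^ (D - 1) := by
        refine mul_le_mul_of_nonneg_right ?_ (by positivity)
        simp only [sextic]
        rw [← Real.exp_add, ← Real.exp_add]
        refine Real.exp_le_exp.2 ?_
        have : √x * r ≤ δ * x + 1 / (4 * δ) * r ^ 2 := by
          have h4 : δ * (1 / (4 * δ)) = 1 / 4 := by field_simp
          have h5 : 0 ≤ 1 / δ * (δ * √x - r / 2) ^ 2 := by positivity
          have h6 : 1 / δ * (δ * √x - r / 2) ^ 2 = δ * √x ^ 2 - √x * r + 1 / (4 * δ) * r ^ 2 := by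
            field_simp
            ring
          rw [Real.sq_sqrt hx] at h6
          linarith
        linarith
    _ = _ := by ring

end

section

variable {D : ℕ}

lemma norm_cpair_le (z : Fin D → ℂ) (x : EuclideanSpace ℝ (Fin D)) :
    ‖cpair z x.ofLp‖ ≤ (∑ j, ‖z j‖) * ‖x‖ := by
  rw [cpair, Finset.sum_mul]
  refine (norm_sum_le _ _).trans (Finset.sum_le_sum fun j _ => ?_)
  rw [norm_mul, Complex.norm_real]
  gcongr
  exact PiLp.norm_apply_le x j

lemma continuous_cpair (z : Fin D → ℂ) :
    Continuous fun x : EuclideanSpace ℝ (Fin D) => cpair z x.ofLp := by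
  unfold cpair; fun_prop

lemma cpair_smul_right (z : Fin D → ℂ) (r : ℝ) (x : Fin D → ℝ) :
    cpair z (r • x) = r * cpair z x := by
  simp only [cpair, Finset.mul_sum, Pi.smul_apply, smul_eq_mul]
  refine Finset.sum_congr rfl fun j _ => ?_
  push_cast
  ring

lemma cpair_smul_left (z : Fin D → ℂ) (t : ℂ) (x : Fin D → ℝ) :
    cpair (t • z) x = t * cpair z x := by
  simp only [cpair, Finset.mul_sum, Pi.smul_apply, smul_eq_mul, mul_assoc]

/-- Moments of the linear form `z · u` over the unit sphere. -/
def sphereMoment (z : Fin D → ℂ) (k : ℕ) : ℂ :=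
  ∫ u : Metric.sphere (0 : EuclideanSpace ℝ (Fin D)) 1, cpair z u.1.ofLp ^ k
    ∂(volume : Measure (EuclideanSpace ℝ (Fin D))).toSphere

lemma sphereMoment_smul (z : Fin D → ℂ) (t : ℂ) (k : ℕ) :
    sphereMoment (t • z) k = t ^ k * sphereMoment z k := by
  simp only [sphereMoment, cpair_smul_left, mul_pow]
  exact integral_const_mul _ _

lemma sphereMoment_zero (hD : 0 < D) :
    ∃ S : ℝ, 0 < S ∧ ∀ z : Fin D → ℂ, sphereMoment z 0 = S := by
  have : Nonempty (Fin D) := ⟨⟨0, hD⟩⟩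
  refine ⟨(volume : Measure (EuclideanSpace ℝ (Fin D))).toSphere.real Set.univ, ?_, fun z => ?_⟩
  · exact ENNReal.toReal_pos
      (Measure.measure_univ_ne_zero.2 (Measure.toSphere_ne_zero _)) (measure_ne_top _ _)
  · simp [sphereMoment]

lemma integral_volumeIoiPow (n : ℕ) (g : ℝ → ℂ) :
    ∫ r : Set.Ioi (0 : ℝ), g r ∂(Measure.volumeIoiPow n) =
      ∫ r in Set.Ioi (0 : ℝ), ((r ^ n : ℝ) : ℂ) * g r := by
  simp only [Measure.volumeIoiPow, ENNReal.ofReal]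
  rw [integral_withDensity_eq_integral_smul,
    integral_subtype_comap measurableSet_Ioi fun a => Real.toNNReal (a ^ n) • g a,
    setIntegral_congr_fun measurableSet_Ioi fun x hx => ?_]
  · rw [NNReal.smul_def, Real.coe_toNNReal _ (pow_nonneg (le_of_lt hx) _), Complex.real_smul]
  · exact (measurable_subtype_coe.pow_const _).real_toNNReal

lemma integral_cpair_pow_mul (hD : 0 < D) (z : Fin D → ℂ) (k : ℕ) (p : ℝ → ℝ) :
    ∫ x : EuclideanSpace ℝ (Fin D), cpair z x.ofLp ^ k * (p ‖x‖ : ℂ) =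
      sphereMoment z k * ((∫ r in Set.Ioi (0 : ℝ), p r * r ^ (D - 1) * r ^ k : ℝ) : ℂ) := by
  have : Nonempty (Fin D) := ⟨⟨0, hD⟩⟩
  set E := EuclideanSpace ℝ (Fin D)
  set f : E → ℂ := fun x => cpair z x.ofLp ^ k * (p ‖x‖ : ℂ) with hf
  set g : Metric.sphere (0 : E) 1 × Set.Ioi (0 : ℝ) → ℂ :=
    fun y => cpair z y.1.1.ofLp ^ k * (((y.2 : ℝ) : ℂ) ^ k * (p y.2 : ℂ)) with hg
  have hfg : ∀ x : ({0}ᶜ : Set E), g (homeomorphUnitSphereProd E x) = f x := by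
    intro x
    have hx : (‖x.1‖ : ℂ) ≠ 0 := by
      rw [Complex.ofReal_ne_zero]
      exact norm_ne_zero_iff.2 x.2
    have e : cpair z (‖x.1‖⁻¹ • x.1).ofLp = ((‖x.1‖⁻¹ : ℝ) : ℂ) * cpair z x.1.ofLp :=
      cpair_smul_right z _ _
    simp only [hg, hf, homeomorphUnitSphereProd_apply_fst_coe,
      homeomorphUnitSphereProd_apply_snd_coe]
    rw [e, ← mul_assoc, ← mul_pow]
    congr 2
    push_cast
    field_simp
  calc ∫ x, f x = ∫ x : ({0}ᶜ : Set E), f x.1 ∂((volume : Measure E).comap (↑)) := by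
        rw [integral_subtype_comap (measurableSet_singleton _).compl f,
          restrict_compl_singleton]
    _ = ∫ y, g y ∂(volume : Measure E).toSphere.prod
          (.volumeIoiPow (Module.finrank ℝ E - 1)) := by
        rw [← (volume : Measure E).measurePreserving_homeomorphUnitSphereProd.integral_comp
          (Homeomorph.measurableEmbedding _) g]
        simp only [hfg]
    _ = sphereMoment z k * ∫ r : Set.Ioi (0 : ℝ), ((r : ℝ) : ℂ) ^ k * (p r : ℂ)
          ∂(.volumeIoiPow (Module.finrank ℝ E - 1)) := by
        rw [sphereMoment, ← integral_prod_mul]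
    _ = _ := by
        rw [integral_volumeIoiPow _ fun r => (r : ℂ) ^ k * (p r : ℂ), finrank_euclideanSpace_fin,
          ← integral_complex_ofReal]
        congr 1
        refine setIntegral_congr_fun measurableSet_Ioi fun r _ => ?_
        push_cast
        ring

lemma hasSum_integral_cexp_cpair (hD : 0 < D) (z : Fin D → ℂ) {p : ℝ → ℝ} (hp : Continuous p)
    (hp0 : ∀ r, 0 ≤ p r)
    (hint : ∀ M, IntegrableOn (fun r => p r * r ^ (D - 1) * Real.exp (M * r)) (Set.Ioi 0)) :
    HasSum (fun k : ℕ => sphereMoment z k / k.factorial *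
        ((∫ r in Set.Ioi (0 : ℝ), p r * r ^ (D - 1) * r ^ k : ℝ) : ℂ))
      (∫ x : EuclideanSpace ℝ (Fin D), cexp (cpair z x.ofLp) * (p ‖x‖ : ℂ)) := by
  have : Nonempty (Fin D) := ⟨⟨0, hD⟩⟩
  set M := ∑ j, ‖z j‖ with hM
  have hM0 : 0 ≤ M := Finset.sum_nonneg fun _ _ => norm_nonneg _
  have hexp : ∀ y : ℝ, HasSum (fun k : ℕ => y ^ k / k.factorial) (Real.exp y) := fun y => by
    rw [Real.exp_eq_exp_ℝ]; exact NormedSpace.expSeries_div_hasSum_exp y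
  have hcexp : ∀ y : ℂ, HasSum (fun k : ℕ => y ^ k / k.factorial) (cexp y) := fun y => by
    rw [Complex.exp_eq_exp_ℂ]; exact NormedSpace.expSeries_div_hasSum_exp y
  have hc := continuous_cpair z
  have h := hasSum_integral_of_dominated_convergence
    (μ := (volume : Measure (EuclideanSpace ℝ (Fin D))))
    (F := fun (k : ℕ) x => cpair z x.ofLp ^ k / k.factorial * (p ‖x‖ : ℂ))
    (f := fun x => cexp (cpair z x.ofLp) * (p ‖x‖ : ℂ))
    (fun k x => (M * ‖x‖) ^ k / k.factorial * p ‖x‖)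
    (fun k => (by fun_prop : Continuous _).aestronglyMeasurable)
    (fun k => Eventually.of_forall fun x => ?_)
    (Eventually.of_forall fun x => ((hexp _).mul_right _).summable) ?_
    (Eventually.of_forall fun x => (hcexp _).mul_right _)
  · refine h.congr_fun fun k => ?_
    rw [div_mul_eq_mul_div, ← integral_cpair_pow_mul hD, ← integral_div]
    exact integral_congr_ae (Eventually.of_forall fun x => by ring)
  · rw [norm_mul, norm_div, norm_pow, Complex.norm_natCast, Complex.norm_of_nonneg (hp0 _)]
    have := hp0 ‖x‖
    gcongr
    exact norm_cpair_le z x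
  · have e : (fun x : EuclideanSpace ℝ (Fin D) =>
        ∑' k : ℕ, (M * ‖x‖) ^ k / k.factorial * p ‖x‖) =
        fun x => (fun r => Real.exp (M * r) * p r) ‖x‖ :=
      funext fun x => ((hexp _).mul_right _).tsum_eq
    rw [e]
    refine (integrable_fun_norm_addHaar volume (f := fun r => Real.exp (M * r) * p r)).2 ?_
    rw [finrank_euclideanSpace_fin]
    refine (hint M).congr_fun (fun r _ => ?_) measurableSet_Ioi
    simp only [smul_eq_mul]
    ring

lemma integrableOn_gaussian (M : ℝ) (k : ℕ) :
    IntegrableOn (fun r => Real.exp (-1 * r ^ 2) * r ^ k * Real.exp (M * r)) (Set.Ioi 0) := by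
  have h : IntegrableOn (fun r : ℝ => r ^ k * Real.exp (-(1 / 2) * r ^ 2)) (Set.Ioi 0) := by
    simpa only [Real.rpow_natCast] using integrableOn_rpow_mul_exp_neg_mul_sq one_half_pos
      (s := (k : ℝ)) (by linarith [(Nat.cast_nonneg k : (0 : ℝ) ≤ k)])
  refine Integrable.mono' (h.const_mul (Real.exp (M ^ 2 / 2)))
    (by fun_prop : Continuous _).aestronglyMeasurable ?_
  filter_upwards [ae_restrict_mem measurableSet_Ioi] with r hr
  have hr' : (0 : ℝ) < r := hr
  rw [Real.norm_of_nonneg (by positivity)]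
  calc Real.exp (-1 * r ^ 2) * r ^ k * Real.exp (M * r)
      = r ^ k * Real.exp (-1 * r ^ 2 + M * r) := by rw [Real.exp_add]; ring
    _ ≤ r ^ k * Real.exp (M ^ 2 / 2 + -(1 / 2) * r ^ 2) := by
        have : -1 * r ^ 2 + M * r ≤ M ^ 2 / 2 + -(1 / 2) * r ^ 2 := by
          nlinarith [sq_nonneg (M - r)]
        gcongr
    _ = _ := by rw [Real.exp_add]; ring

/-- Radial moments of the Gaussian density in dimension `D`. -/
def gaussMoment (D k : ℕ) : ℝ := ∫ r in Set.Ioi (0 : ℝ), Real.exp (-1 * r ^ 2) * r ^ (D - 1) * r ^ k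

lemma gaussMoment_eq (hD : 0 < D) (k : ℕ) : gaussMoment D k = Real.Gamma ((k + D) / 2) / 2 := by
  have h := integral_rpow_mul_exp_neg_rpow (p := 2) (q := ((D - 1 + k : ℕ) : ℝ)) two_pos
    (by linarith [(Nat.cast_nonneg (D - 1 + k) : (0 : ℝ) ≤ _)])
  simp only [Real.rpow_natCast, Real.rpow_two] at h
  have e : (((D - 1 + k : ℕ) : ℝ) + 1) / 2 = (k + D) / 2 := by
    rw [Nat.cast_add, Nat.cast_sub hD]
    push_cast
    ring
  rw [e] at h
  rw [gaussMoment, div_eq_mul_one_div, mul_comm, ← h]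
  refine setIntegral_congr_fun measurableSet_Ioi fun r _ => ?_
  simp only [pow_add, neg_one_mul]
  ring

lemma gaussMoment_pos (hD : 0 < D) (k : ℕ) : 0 < gaussMoment D k := by
  rw [gaussMoment_eq hD]
  have : (0 : ℝ) < D := by exact_mod_cast hD
  have := Real.Gamma_pos_of_pos (s := (k + D) / 2) (by positivity)
  positivity

lemma gaussMoment_add_two (hD : 0 < D) (k : ℕ) :
    gaussMoment D (k + 2) = (k + D) / 2 * gaussMoment D k := by
  have : (0 : ℝ) < D := by exact_mod_cast hD
  rw [gaussMoment_eq hD, gaussMoment_eq hD]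
  have e : (((k + 2 : ℕ) : ℝ) + D) / 2 = (k + D) / 2 + 1 := by push_cast; ring
  rw [e, Real.Gamma_add_one (by positivity)]
  ring

lemma besselCoeff_mul_gaussMoment (hD : 0 < D) (n : ℕ) :
    besselCoeff D n * (n.factorial * 4 ^ n * gaussMoment D (2 * n)) = gaussMoment D 0 := by
  have : (0 : ℝ) < D := by exact_mod_cast hD
  induction n with
  | zero => simp [besselCoeff]
  | succ n ih =>
    rw [← ih, show 2 * (n + 1) = 2 * n + 2 by ring, gaussMoment_add_two hD, besselCoeff,
      Nat.factorial_succ]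
    push_cast
    field_simp
    ring

lemma cdot_smul_smul (t : ℂ) (z : Fin D → ℂ) : cdot (t • z) (t • z) = t ^ 2 * cdot z z := by
  simp only [cdot, Finset.mul_sum, Pi.smul_apply, smul_eq_mul]
  exact Finset.sum_congr rfl fun j _ => by ring

lemma integral_euclideanSpace_eq (f : (Fin D → ℝ) → ℂ) :
    ∫ x : EuclideanSpace ℝ (Fin D), f x.ofLp = ∫ x, f x := by
  rw [← (PiLp.volume_preserving_toLp (Fin D)).integral_comp
    (MeasurableEquiv.toLp 2 _).measurableEmbedding]

lemma norm_sq_eq_rdot (x : EuclideanSpace ℝ (Fin D)) : ‖x‖ ^ 2 = rdot x.ofLp x.ofLp := by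
  rw [EuclideanSpace.norm_sq_eq, rdot]
  exact Finset.sum_congr rfl fun j _ => by rw [Real.norm_eq_abs, sq_abs, sq]

lemma integral_cexp_cpair_gaussian (z : Fin D → ℂ) :
    ∫ x : EuclideanSpace ℝ (Fin D), cexp (cpair z x.ofLp) * (Real.exp (-1 * ‖x‖ ^ 2) : ℂ) =
      (Real.pi : ℂ) ^ (D / 2 : ℂ) * cexp (cdot z z / 4) := by
  have h := GaussianFourier.integral_cexp_neg_mul_sum_add (b := 1) (by simp) z
  simp only [norm_sq_eq_rdot]
  rw [integral_euclideanSpace_eq fun x => cexp (cpair z x) * (Real.exp (-1 * rdot x x) : ℂ)]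
  simp only [div_one, mul_one, Fintype.card_fin] at h
  simp only [cdot, ← sq]
  rw [← h]
  refine integral_congr_ae (Eventually.of_forall fun x => ?_)
  simp only [Complex.ofReal_exp, ← Complex.exp_add, cpair, rdot]
  push_cast
  simp only [← sq, add_comm]

lemma eq_of_hasSum_pow {f g : ℕ → ℂ} {F : ℂ → ℂ} (hf : ∀ t, HasSum (fun n => t ^ n * f n) (F t))
    (hg : ∀ t, HasSum (fun n => t ^ n * g n) (F t)) : f = g := by
  have key : ∀ u : ℕ → ℂ, (∀ t, HasSum (fun n => t ^ n * u n) (F t)) →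
      HasFPowerSeriesAt F (FormalMultilinearSeries.ofScalars ℂ u) 0 := fun u hu => by
    rw [hasFPowerSeriesAt_iff]
    refine Eventually.of_forall fun t => ?_
    simpa [FormalMultilinearSeries.coeff_ofScalars] using hu t
  have h := (key f hf).eq_formalMultilinearSeries (key g hg)
  ext n
  simpa [FormalMultilinearSeries.coeff_ofScalars] using congrArg (fun p => p.coeff n) h

lemma sphereMoment_mul_gaussMoment (hD : 0 < D) (z : Fin D → ℂ) (k : ℕ) :
    sphereMoment z k / k.factorial * (gaussMoment D k : ℂ) =
      if Even k then (Real.pi : ℂ) ^ (D / 2 : ℂ) * ((cdot z z / 4) ^ (k / 2) / (k / 2).factorial)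
      else 0 := by
  refine congrFun (eq_of_hasSum_pow
    (f := fun k => sphereMoment z k / k.factorial * (gaussMoment D k : ℂ))
    (g := fun k => if Even k then
      (Real.pi : ℂ) ^ (D / 2 : ℂ) * ((cdot z z / 4) ^ (k / 2) / (k / 2).factorial) else 0)
    (F := fun t => (Real.pi : ℂ) ^ (D / 2 : ℂ) * cexp (t ^ 2 * cdot z z / 4))
    (fun t => ?_) (fun t => ?_)) k
  · have h := hasSum_integral_cexp_cpair hD (t • z) (p := fun r => Real.exp (-1 * r ^ 2))
      (by fun_prop) (fun r => (Real.exp_pos _).le) (fun M => integrableOn_gaussian M _)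
    rw [integral_cexp_cpair_gaussian, cdot_smul_smul] at h
    refine h.congr_fun fun k => ?_
    rw [sphereMoment_smul, gaussMoment]
    ring
  · rw [← add_zero (_ * _)]
    refine HasSum.even_add_odd ?_ ?_
    · have h : HasSum (fun n : ℕ => (t ^ 2 * cdot z z / 4) ^ n / n.factorial)
          (cexp (t ^ 2 * cdot z z / 4)) := by
        rw [Complex.exp_eq_exp_ℂ]; exact NormedSpace.expSeries_div_hasSum_exp _
      refine (h.mul_left _).congr_fun fun n => ?_
      rw [if_pos (even_two_mul n), Nat.mul_div_cancel_left n two_pos, pow_mul, mul_div_assoc,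
        mul_pow]
      ring
    · convert hasSum_zero using 2 with n
      rw [if_neg (by simp), mul_zero]

lemma sphereMoment_odd (hD : 0 < D) (z : Fin D → ℂ) (n : ℕ) : sphereMoment z (2 * n + 1) = 0 := by
  have h := sphereMoment_mul_gaussMoment hD z (2 * n + 1)
  rw [if_neg (by simp)] at h
  have h1 : (gaussMoment D (2 * n + 1) : ℂ) ≠ 0 := by
    exact_mod_cast (gaussMoment_pos hD _).ne'
  have h2 : ((2 * n + 1).factorial : ℂ) ≠ 0 := by exact_mod_cast Nat.factorial_ne_zero _
  simpa [h1, h2] using h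

lemma sphereMoment_even (hD : 0 < D) (z : Fin D → ℂ) (n : ℕ) :
    sphereMoment z (2 * n) / (2 * n).factorial =
      sphereMoment z 0 * besselCoeff D n * cdot z z ^ n := by
  have h0 := sphereMoment_mul_gaussMoment hD z 0
  have h := sphereMoment_mul_gaussMoment hD z (2 * n)
  have hb : (besselCoeff D n : ℂ) * (n.factorial * 4 ^ n * gaussMoment D (2 * n)) =
      gaussMoment D 0 := by
    exact_mod_cast congrArg (fun r : ℝ => (r : ℂ)) (besselCoeff_mul_gaussMoment hD n)
  rw [if_pos (even_two_mul n), Nat.mul_div_cancel_left n two_pos] at h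
  simp only [Even.zero, if_true, Nat.factorial_zero, Nat.cast_one, div_one, Nat.zero_div, pow_zero,
    mul_one] at h0
  have h1 : (gaussMoment D (2 * n) : ℂ) ≠ 0 := by exact_mod_cast (gaussMoment_pos hD _).ne'
  have h2 : (n.factorial : ℂ) ≠ 0 := by exact_mod_cast Nat.factorial_ne_zero _
  refine mul_right_cancel₀ h1 (h.trans ?_)
  rw [← h0, ← hb, div_pow]
  field_simp

lemma hasSum_sexticTransform (hD : 0 < D) {b c : ℝ} (hb : 0 < b) (hc : 0 < c) (a : ℝ) (w : ℂ) :
    HasSum (fun n : ℕ => besselCoeff D n * w ^ n *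
      ((∫ r in Set.Ioi (0 : ℝ), sextic a b c r * r ^ (D - 1) * r ^ (2 * n) : ℝ) : ℂ))
      (sexticTransform D a b c w) := by
  set M := √‖w‖ with hM
  have hM2 : M ^ 2 = ‖w‖ := Real.sq_sqrt (norm_nonneg _)
  have hs := continuous_sextic a b c
  have h0 : ∀ r, 0 ≤ sextic a b c r := fun r => (Real.exp_pos _).le
  have h := hasSum_integral_of_dominated_convergence
    (μ := volume.restrict (Set.Ioi (0 : ℝ)))
    (F := fun (n : ℕ) r => ((sextic a b c r * r ^ (D - 1) : ℝ) : ℂ) *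
      (besselCoeff D n * (w * r ^ 2) ^ n))
    (f := fun r => ((sextic a b c r * r ^ (D - 1) : ℝ) : ℂ) * bessel D (w * r ^ 2))
    (fun n r => sextic a b c r * r ^ (D - 1) * ((M * r) ^ (2 * n) / (2 * n).factorial))
    (fun n => (by fun_prop : Continuous _).aestronglyMeasurable)
    (fun n => ?_) (Eventually.of_forall fun r => ((Real.hasSum_cosh _).mul_left _).summable) ?_
    (Eventually.of_forall fun r => (summable_term (abs_besselCoeff_le hD) _).hasSum.mul_left _)
  · refine h.congr_fun fun n => ?_
    rw [← integral_complex_ofReal, ← integral_const_mul]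
    refine setIntegral_congr_fun measurableSet_Ioi fun r _ => ?_
    push_cast
    ring
  · filter_upwards [ae_restrict_mem measurableSet_Ioi] with r hr
    have hr' : (0 : ℝ) < r := hr
    have := h0 r
    rw [norm_mul, Complex.norm_of_nonneg (by positivity), norm_mul, norm_pow, norm_mul,
      Complex.norm_of_nonneg (besselCoeff_pos hD n).le, norm_pow, Complex.norm_of_nonneg hr'.le,
      ← hM2, ← mul_pow, ← pow_mul, div_eq_mul_one_div, mul_comm (besselCoeff D n)]
    gcongr
    exact besselCoeff_le hD n
  · have e : (fun r : ℝ => ∑' n : ℕ,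
        sextic a b c r * r ^ (D - 1) * ((M * r) ^ (2 * n) / (2 * n).factorial)) =
        fun r => sextic a b c r * r ^ (D - 1) * Real.cosh (M * r) :=
      funext fun r => ((Real.hasSum_cosh _).mul_left _).tsum_eq
    rw [e]
    refine (((integrableOn_sextic hb hc a M (D - 1)).add
      (integrableOn_sextic hb hc a (-M) (D - 1))).div_const 2).congr
      (Eventually.of_forall fun r => ?_)
    simp only [Pi.add_apply, Real.cosh_eq, neg_mul]
    ring

lemma integral_cexp_cpair_sextic (hD : 0 < D) {b c : ℝ} (hb : 0 < b) (hc : 0 < c) (a : ℝ)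
    (z : Fin D → ℂ) :
    ∫ x : EuclideanSpace ℝ (Fin D), cexp (cpair z x.ofLp) * (sextic a b c ‖x‖ : ℂ) =
      sphereMoment z 0 * sexticTransform D a b c (cdot z z) := by
  have h := hasSum_integral_cexp_cpair hD z (continuous_sextic a b c)
    (fun r => (Real.exp_pos _).le) (fun M => integrableOn_sextic hb hc a M _)
  refine h.unique ?_
  rw [← add_zero (_ * _)]
  refine HasSum.even_add_odd ?_ ?_
  · refine ((hasSum_sexticTransform hD hb hc a (cdot z z)).mul_left _).congr_fun fun n => ?_
    rw [sphereMoment_even hD]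
    ring
  · convert hasSum_zero using 2 with n
    rw [sphereMoment_odd hD, zero_div, zero_mul]

lemma integral_cexp_cpair_sub (hD : 0 < D) {b c : ℝ} (hb : 0 < b) (hc : 0 < c) (a : ℝ)
    (z : Fin D → ℂ) :
    ∫ σ : Fin D → ℝ, cexp (cpair z σ -
        ((a * rdot σ σ + b * (rdot σ σ) ^ 2 + c * (rdot σ σ) ^ 3 : ℝ) : ℂ)) =
      sphereMoment z 0 * sexticTransform D a b c (cdot z z) := by
  rw [← integral_cexp_cpair_sextic hD hb hc, ← integral_euclideanSpace_eq]
  refine integral_congr_ae (Eventually.of_forall fun x => ?_)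
  simp only [sextic]
  rw [norm_sq_eq_rdot, Complex.ofReal_exp, ← Complex.exp_add, Complex.ofReal_neg, sub_eq_add_neg]

end

end LeeYang

/-- **The sextic single-spin measure `exp(-a|σ|² - b|σ|⁴ - c|σ|⁶)dσ` has the Lee–Yang
property in every dimension `D`, provided `b, c > 0` and `a ≤ b²/(3c)`.** -/
theorem leeYang_phi6
    (D : ℕ) (hD : 0 < D) (a b c : ℝ) (hb : 0 < b) (hc : 0 < c)
    (ha : a ≤ b ^ 2 / (3 * c)) :
    ∃ (C : ℝ) (γ : ℕ → ℝ), 0 < C ∧ (∀ j, 0 ≤ γ j) ∧ Summable γ ∧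
      ∀ z : Fin D → ℂ,
        (∫ σ : Fin D → ℝ,
          Complex.exp (cpair z σ -
            ((a * rdot σ σ + b * (rdot σ σ) ^ 2 + c * (rdot σ σ) ^ 3 : ℝ) : ℂ)))
          = (C : ℂ) * ∏' j, (1 + (γ j : ℂ) * cdot z z) := by
  obtain ⟨S, hS, hSz⟩ := LeeYang.sphereMoment_zero hD
  obtain ⟨C, γ, hC, hγ, hsum, h⟩ := LeeYang.exists_prod_sexticTransform hD hb hc ha
  refine ⟨S * C, γ, mul_pos hS hC, hγ, hsum, fun z => ?_⟩
  rw [LeeYang.integral_cexp_cpair_sub hD hb hc, hSz, h, Complex.ofReal_mul, mul_assoc]
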